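/- arXiv:2507.10987 — 4 statements merged into one kernel-verified Lean document; each statement's English description precedes it below -/
import Mathlib

section
/- Let f be a monic matrix polynomial of degree 2m+1 (A_0 = I_q) and suppose Hermitian q×q matrices s_0, ..., s_{2m} are Markov parameters of f. Then f is a Hurwitz-type matrix (HTM) polynomial if and only if H_{1,m} and H_{2,m-1} are positive definite and f(z) = (−1)^m ( Q_{2,m}^♯(−z²) + z·P_{2,m}^♯(−z²) ) for all z ∈ ℂ, where P_{2,m} and Q_{2,m} are the matrix polynomials built from s_0, ..., s_{2m}. -/
open Matrix MeasureTheory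
open scoped ComplexOrder

noncomputable section

/-- The space of `q × q` complex matrices. -/
abbrev Mat (q : ℕ) := Matrix (Fin q) (Fin q) ℂ

/-- The h-part of an even-degree matrix polynomial
`f(z) = A 0 * z^(2m) + ... + A (2m)`:  `h(z) = A 0 * z^m + A 2 * z^(m-1) + ... + A (2m)`. -/
def hEven (q m : ℕ) (A : ℕ → Mat q) (z : ℂ) : Mat q :=
  ∑ j ∈ Finset.range (m + 1), z ^ (m - j) • A (2 * j)

/-- The g-part of an even-degree matrix polynomial:
`g(z) = A 1 * z^(m-1) + A 3 * z^(m-2) + ... + A (2m-1)`. -/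
def gEven (q m : ℕ) (A : ℕ → Mat q) (z : ℂ) : Mat q :=
  ∑ j ∈ Finset.range m, z ^ (m - 1 - j) • A (2 * j + 1)

/-- The h-part of an odd-degree matrix polynomial
`f(z) = A 0 * z^(2m+1) + ... + A (2m+1)`:  `h(z) = A 1 * z^m + ... + A (2m+1)`. -/
def hOdd (q m : ℕ) (A : ℕ → Mat q) (z : ℂ) : Mat q :=
  ∑ j ∈ Finset.range (m + 1), z ^ (m - j) • A (2 * j + 1)

/-- The g-part of an odd-degree matrix polynomial: `g(z) = A 0 * z^m + ... + A (2m)`. -/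
def gOdd (q m : ℕ) (A : ℕ → Mat q) (z : ℂ) : Mat q :=
  ∑ j ∈ Finset.range (m + 1), z ^ (m - j) • A (2 * j)

/-- The matrix polynomial `f(z) = A 0 * z^n + A 1 * z^(n-1) + ... + A n`. -/
def fPoly (q n : ℕ) (A : ℕ → Mat q) (z : ℂ) : Mat q :=
  ∑ j ∈ Finset.range (n + 1), z ^ (n - j) • A j

/-- Continued fraction for the even case:  `wEven q m c d j z = w_{m-1-j}(z)`, where
`w_{m-1}(z) = z c_{m-1} + d_{m-1}⁻¹` and `w_k(z) = z c_k + (d_k + w_{k+1}(z)⁻¹)⁻¹`. -/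
def wEven (q m : ℕ) (c d : ℕ → Mat q) : ℕ → ℂ → Mat q
  | 0, z => z • c (m - 1) + (d (m - 1))⁻¹
  | j + 1, z => z • c (m - 2 - j) + (d (m - 2 - j) + (wEven q m c d j z)⁻¹)⁻¹

/-- Continued fraction for the odd case:  `wOdd q m c d j z = w_{m-1-j}(z)`, where
`w_{m-1}(z) = z c_{m-1} + (d_{m-1} + z⁻¹ c_m⁻¹)⁻¹`. -/
def wOdd (q m : ℕ) (c d : ℕ → Mat q) : ℕ → ℂ → Mat q
  | 0, z => z • c (m - 1) + (d (m - 1) + z⁻¹ • (c m)⁻¹)⁻¹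
  | j + 1, z => z • c (m - 2 - j) + (d (m - 2 - j) + (wOdd q m c d j z)⁻¹)⁻¹

/-- A Hurwitz-type matrix polynomial of degree 2m, described through its h-part and g-part:
there are Hermitian positive definite matrices `c_0, ..., c_{m-1}`, `d_0, ..., d_{m-1}` with
`g(z) h(z)⁻¹ = w_0(z)⁻¹` whenever `det (h z) ≠ 0` and all inverses in the recursion exist. -/
def IsHTMEven (q m : ℕ) (h g : ℂ → Mat q) : Prop :=
  ∃ c d : ℕ → Mat q,
    (∀ k < m, (c k).PosDef) ∧ (∀ k < m, (d k).PosDef) ∧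
    ∀ z : ℂ, (h z).det ≠ 0 →
      (∀ j < m, IsUnit (wEven q m c d j z).det) →
      (∀ j, j + 1 < m → IsUnit (d (m - 2 - j) + (wEven q m c d j z)⁻¹).det) →
      g z * (h z)⁻¹ = (wEven q m c d (m - 1) z)⁻¹

/-- A Hurwitz-type matrix polynomial of degree 2m+1, described through its h-part and g-part:
there are Hermitian positive definite matrices `c_0, ..., c_m`, `d_0, ..., d_{m-1}` with
`h(z) (z g(z))⁻¹ = w_0(z)⁻¹` whenever `z ≠ 0`, `det (g z) ≠ 0` and all inverses exist. -/
def IsHTMOdd (q m : ℕ) (h g : ℂ → Mat q) : Prop :=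
  ∃ c d : ℕ → Mat q,
    (∀ k ≤ m, (c k).PosDef) ∧ (∀ k < m, (d k).PosDef) ∧
    ∀ z : ℂ, z ≠ 0 → (g z).det ≠ 0 →
      IsUnit (d (m - 1) + z⁻¹ • (c m)⁻¹).det →
      (∀ j < m, IsUnit (wOdd q m c d j z).det) →
      (∀ j, j + 1 < m → IsUnit (d (m - 2 - j) + (wOdd q m c d j z)⁻¹).det) →
      h z * (z • g z)⁻¹ = (wOdd q m c d (m - 1) z)⁻¹

/-- `s_0, ..., s_{2m-1}` are Markov parameters of the even-degree polynomial with
coefficients `A`:  `z^(2m) g(z) - (∑_{j<2m} (-1)^j s_j z^(2m-1-j)) h(z)` has degree ≤ m-1. -/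
def MarkovEven (q m : ℕ) (A s : ℕ → Mat q) : Prop :=
  ∃ B : ℕ → Mat q, ∀ z : ℂ,
    z ^ (2 * m) • gEven q m A z
      - (∑ j ∈ Finset.range (2 * m), ((-1 : ℂ) ^ j * z ^ (2 * m - 1 - j)) • s j) * hEven q m A z
    = ∑ k ∈ Finset.range m, z ^ k • B k

/-- `s_0, ..., s_{2m}` are Markov parameters of the odd-degree polynomial with coefficients
`A`:  `z^(2m+1) h(z) - (∑_{j≤2m} (-1)^j s_j z^(2m-j)) z g(z)` has degree ≤ m. -/
def MarkovOdd (q m : ℕ) (A s : ℕ → Mat q) : Prop :=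
  ∃ B : ℕ → Mat q, ∀ z : ℂ,
    z ^ (2 * m + 1) • hOdd q m A z
      - (∑ j ∈ Finset.range (2 * m + 1), ((-1 : ℂ) ^ j * z ^ (2 * m - j)) • s j) *
          (z • gOdd q m A z)
    = ∑ k ∈ Finset.range (m + 1), z ^ k • B k

/-- The block Hankel matrix `H_{1,n-1} = (s_{i+j})_{i,j=0}^{n-1}` with `n` block rows. -/
def H1b (q : ℕ) (s : ℕ → Mat q) (n : ℕ) : Matrix (Fin n × Fin q) (Fin n × Fin q) ℂ :=
  Matrix.of fun p r => s ((p.1 : ℕ) + (r.1 : ℕ)) p.2 r.2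

/-- The block Hankel matrix `H_{2,n-1} = (s_{i+j+1})_{i,j=0}^{n-1}` with `n` block rows. -/
def H2b (q : ℕ) (s : ℕ → Mat q) (n : ℕ) : Matrix (Fin n × Fin q) (Fin n × Fin q) ℂ :=
  Matrix.of fun p r => s ((p.1 : ℕ) + (r.1 : ℕ) + 1) p.2 r.2

/-- The block column `Y_{1,n} = (s_n; s_{n+1}; ...; s_{2n-1})`. -/
def Y1b (q : ℕ) (s : ℕ → Mat q) (n : ℕ) : Matrix (Fin n × Fin q) (Fin q) ℂ :=
  Matrix.of fun p b => s (n + (p.1 : ℕ)) p.2 b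

/-- The block column `Y_{2,n} = (s_{n+1}; ...; s_{2n})`. -/
def Y2b (q : ℕ) (s : ℕ → Mat q) (n : ℕ) : Matrix (Fin n × Fin q) (Fin q) ℂ :=
  Matrix.of fun p b => s (n + 1 + (p.1 : ℕ)) p.2 b

/-- The block column `col (I, z I, ..., z^(n-1) I)`. -/
def colPow (q n : ℕ) (z : ℂ) : Matrix (Fin n × Fin q) (Fin q) ℂ :=
  Matrix.of fun p b => z ^ (p.1 : ℕ) * (if p.2 = b then 1 else 0)

/-- `r_i(z) = ∑_{k=1}^{i} z^(i-k) s_{k-1}`. -/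
def rPol (q : ℕ) (s : ℕ → Mat q) (i : ℕ) (z : ℂ) : Mat q :=
  ∑ k ∈ Finset.range i, z ^ (i - 1 - k) • s k

/-- `t_i(z) = ∑_{k=0}^{i} z^(i-k) s_k`. -/
def tPol (q : ℕ) (s : ℕ → Mat q) (i : ℕ) (z : ℂ) : Mat q :=
  ∑ k ∈ Finset.range (i + 1), z ^ (i - k) • s k

/-- The block column `col (r_0(z), ..., r_{n-1}(z))`. -/
def colR (q : ℕ) (s : ℕ → Mat q) (n : ℕ) (z : ℂ) : Matrix (Fin n × Fin q) (Fin q) ℂ :=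
  Matrix.of fun p b => rPol q s (p.1 : ℕ) z p.2 b

/-- The block column `col (t_0(z), ..., t_{n-1}(z))`. -/
def colT (q : ℕ) (s : ℕ → Mat q) (n : ℕ) (z : ℂ) : Matrix (Fin n × Fin q) (Fin q) ℂ :=
  Matrix.of fun p b => tPol q s (p.1 : ℕ) z p.2 b

/-- `P_{1,j}(z) = z^j I - Y_{1,j}^* H_{1,j-1}⁻¹ col(I, zI, ..., z^(j-1) I)`. -/
def P1 (q : ℕ) (s : ℕ → Mat q) (j : ℕ) (z : ℂ) : Mat q :=
  z ^ j • (1 : Mat q) - (Y1b q s j)ᴴ * (H1b q s j)⁻¹ * colPow q j z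

/-- `P_{2,j}(z) = z^j I - Y_{2,j}^* H_{2,j-1}⁻¹ col(I, zI, ..., z^(j-1) I)`. -/
def P2 (q : ℕ) (s : ℕ → Mat q) (j : ℕ) (z : ℂ) : Mat q :=
  z ^ j • (1 : Mat q) - (Y2b q s j)ᴴ * (H2b q s j)⁻¹ * colPow q j z

/-- `Q_{1,j}(z) = r_j(z) - Y_{1,j}^* H_{1,j-1}⁻¹ col(r_0(z), ..., r_{j-1}(z))`. -/
def Q1 (q : ℕ) (s : ℕ → Mat q) (j : ℕ) (z : ℂ) : Mat q :=
  rPol q s j z - (Y1b q s j)ᴴ * (H1b q s j)⁻¹ * colR q s j z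

/-- `Q_{2,j}(z) = t_j(z) - Y_{2,j}^* H_{2,j-1}⁻¹ col(t_0(z), ..., t_{j-1}(z))`. -/
def Q2 (q : ℕ) (s : ℕ → Mat q) (j : ℕ) (z : ℂ) : Mat q :=
  tPol q s j z - (Y2b q s j)ᴴ * (H2b q s j)⁻¹ * colT q s j z

/-- The block column `e = (I; 0; ...; 0)` with `n` blocks. -/
def eCol (q n : ℕ) : Matrix (Fin n × Fin q) (Fin q) ℂ :=
  Matrix.of fun p b => if (p.1 : ℕ) = 0 then (if p.2 = b then 1 else 0) else 0

/-- The block column `y = (s_0; s_1; ...; s_{n-1})`. -/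
def yCol (q : ℕ) (s : ℕ → Mat q) (n : ℕ) : Matrix (Fin n × Fin q) (Fin q) ℂ :=
  Matrix.of fun p b => s (p.1 : ℕ) p.2 b

/-- Condition C: `A_i^* A_k = A_k^* A_i` for every odd `i` and even `k` with `i, k ≤ n`. -/
def CondC (q n : ℕ) (A : ℕ → Mat q) : Prop :=
  ∀ i k, i ≤ n → k ≤ n → i % 2 = 1 → k % 2 = 0 → (A i)ᴴ * A k = (A k)ᴴ * A i

/-- The symmetrizer: for a polynomial with (descending) coefficients `Q_0, ..., Q_{n-1}`
(read off as `Q_j = A (2j)`), the `n × n` block Hankel matrix whose `(i,k)` block is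
`A (2(n-1-i-k))` if `i + k ≤ n - 1`, and `0` otherwise. -/
def Sh (q n : ℕ) (A : ℕ → Mat q) : Matrix (Fin n × Fin q) (Fin n × Fin q) ℂ :=
  Matrix.of fun p r =>
    if (p.1 : ℕ) + (r.1 : ℕ) ≤ n - 1 then A (2 * (n - 1 - (p.1 : ℕ) - (r.1 : ℕ))) p.2 r.2
    else 0

/-- The signature matrix `J̃ = diag (I, -I, I, ..., ±I)` with `n` blocks. -/
def Jt (q n : ℕ) : Matrix (Fin n × Fin q) (Fin n × Fin q) ℂ :=
  Matrix.diagonal (fun p => (-1 : ℂ) ^ (p.1 : ℕ))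

/-- The block row `(I, x² I, ..., x^(2n-2) I)`. -/
def Rev (q n : ℕ) (x : ℂ) : Matrix (Fin q) (Fin n × Fin q) ℂ :=
  Matrix.of fun a p => x ^ (2 * (p.1 : ℕ)) * (if a = p.2 then 1 else 0)

/-- The block column `(I; y² I; ...; y^(2n-2) I)`. -/
def Cev (q n : ℕ) (y : ℂ) : Matrix (Fin n × Fin q) (Fin q) ℂ :=
  Matrix.of fun p b => y ^ (2 * (p.1 : ℕ)) * (if p.2 = b then 1 else 0)

/-- The block row `(x I, x³ I, ..., x^(2n-1) I)`. -/
def Rod (q n : ℕ) (x : ℂ) : Matrix (Fin q) (Fin n × Fin q) ℂ :=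
  Matrix.of fun a p => x ^ (2 * (p.1 : ℕ) + 1) * (if a = p.2 then 1 else 0)

/-- The block column `(y I; y³ I; ...; y^(2n-1) I)`. -/
def Cod (q n : ℕ) (y : ℂ) : Matrix (Fin n × Fin q) (Fin q) ℂ :=
  Matrix.of fun p b => y ^ (2 * (p.1 : ℕ) + 1) * (if p.2 = b then 1 else 0)

section HankelIdentities

open PowerSeries

variable {R : Type*} [Ring R] {e b : R⟦X⟧} {c : R}

theorem sum_coeff_mul_coeff_of_mul_eq_one (he : e * (C c - X * b) = 1) (n : ℕ) :
    ∑ p ∈ Finset.range (n + 1), coeff (n - p) e * coeff p b = coeff (n + 1) e * c := by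
  have h := congrArg (coeff (n + 1)) he
  rw [mul_sub, ← mul_assoc, (commute_X e).eq, mul_assoc, map_sub, coeff_succ_X_mul,
    coeff_mul_C, coeff_one, if_neg n.succ_ne_zero, sub_eq_zero, coeff_mul,
    ← Finset.Nat.sum_antidiagonal_swap,
    Finset.Nat.sum_antidiagonal_eq_sum_range_succ_mk] at h
  exact h.symm

theorem sum_coeff_mul_coeff_of_mul_eq_one' (he : (C c - X * b) * e = 1) (n : ℕ) :
    ∑ p ∈ Finset.range (n + 1), coeff p b * coeff (n - p) e = c * coeff (n + 1) e := by
  have h := congrArg (coeff (n + 1)) he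
  rw [sub_mul, mul_assoc, map_sub, coeff_succ_X_mul,
    coeff_C_mul, coeff_one, if_neg n.succ_ne_zero, sub_eq_zero, coeff_mul,
    Finset.Nat.sum_antidiagonal_eq_sum_range_succ_mk] at h
  exact h.symm

/-- If `e` and `C c - X * b` are mutually inverse, the coefficients of `e` shifted by one are the
double convolution of the coefficients of `e`, `b` and `e`. -/
theorem sum_coeff_mul_coeff_mul_coeff (he : e * (C c - X * b) = 1)
    (he' : (C c - X * b) * e = 1) (i j : ℕ) :
    ∑ p ∈ Finset.range (i + 1), ∑ r ∈ Finset.range (j + 1),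
      coeff (i - p) e * coeff (p + r) b * coeff (j - r) e = coeff (i + j + 1) e := by
  have hc : c * coeff 0 e = 1 := by
    simpa using congrArg (coeff 0) he'
  induction j generalizing i with
  | zero =>
    simp only [zero_add, Finset.range_one, Finset.sum_singleton, add_zero, Nat.sub_zero]
    rw [← Finset.sum_mul, sum_coeff_mul_coeff_of_mul_eq_one he, mul_assoc, hc, mul_one]
  | succ j ih =>
    rw [show i + (j + 1) + 1 = (i + 1) + j + 1 by ring, ← ih (i + 1),
      Finset.sum_range_succ' _ (i + 1)]
    simp only [Finset.sum_range_succ' _ (j + 1), Finset.sum_add_distrib, Nat.reduceSubDiff,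
      add_zero, Nat.sub_zero, zero_add]
    rw [← Finset.sum_mul, sum_coeff_mul_coeff_of_mul_eq_one he]
    simp only [mul_assoc, ← Finset.mul_sum, sum_coeff_mul_coeff_of_mul_eq_one' he']
    simp only [Finset.mul_sum, add_assoc, add_comm 1]

/-- If `e` and `C c - X * b` are mutually inverse, the coefficients of `e` shifted by two are a
weighted double convolution of the coefficients of `e`, of `b` shifted by one, and of `e`. -/
theorem sum_coeff_mul_coeff_mul_coeff_succ (he : e * (C c - X * b) = 1)
    (he' : (C c - X * b) * e = 1) (i j : ℕ) :
    coeff (i + 1) e * c * coeff (j + 1) e +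
      ∑ p ∈ Finset.range (i + 1), ∑ r ∈ Finset.range (j + 1),
        coeff (i - p) e * coeff (p + r + 1) b * coeff (j - r) e = coeff (i + j + 2) e := by
  rw [show i + j + 2 = i + (j + 1) + 1 by ring, ← sum_coeff_mul_coeff_mul_coeff he he' i (j + 1)]
  simp only [Finset.sum_range_succ' _ (j + 1), Finset.sum_add_distrib, Nat.reduceSubDiff,
      add_zero, Nat.sub_zero]
  rw [← Finset.sum_mul, sum_coeff_mul_coeff_of_mul_eq_one he, add_comm]
  rfl

end HankelIdentities

section Toeplitz

open PowerSeries

variable {R : Type*} [Ring R]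

/-- The `n × n` lower triangular Toeplitz matrix of the coefficients of a power series. -/
def toeplitz (n : ℕ) (e : R⟦X⟧) : Matrix (Fin n) (Fin n) R :=
  Matrix.of fun i j => if (j : ℕ) ≤ i then coeff (i - j) e else 0

theorem sum_toeplitz_mul {n : ℕ} (e : R⟦X⟧) (F : ℕ → R) (i : Fin n) :
    ∑ p : Fin n, toeplitz n e i p * F p =
      ∑ p ∈ Finset.range (i + 1), coeff (i - p) e * F p := by
  simp only [toeplitz, Matrix.of_apply]
  rw [Fin.sum_univ_eq_sum_range (fun p => (if p ≤ (i : ℕ) then coeff (i - p) e else 0) * F p) n]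
  simp only [ite_mul, zero_mul]
  rw [← Finset.sum_filter]
  refine Finset.sum_congr ?_ fun _ _ => rfl
  ext p
  simp only [Finset.mem_filter, Finset.mem_range]
  omega

theorem toeplitz_mul (n : ℕ) (e f : R⟦X⟧) :
    toeplitz n e * toeplitz n f = toeplitz n (e * f) := by
  ext i j
  rw [Matrix.mul_apply]
  have h := sum_toeplitz_mul e (fun p => if (j : ℕ) ≤ p then coeff (p - j) f else 0) i
  refine h.trans ?_
  simp only [toeplitz, Matrix.of_apply]
  split_ifs with hij
  · obtain ⟨k, hk⟩ := Nat.exists_eq_add_of_le hij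
    rw [hk, add_assoc, Finset.sum_range_add, Finset.sum_eq_zero, zero_add, coeff_mul,
      ← Finset.Nat.sum_antidiagonal_swap, Finset.Nat.sum_antidiagonal_eq_sum_range_succ_mk]
    · simp [Nat.add_sub_add_left]
    · intro p hp
      rw [Finset.mem_range] at hp
      rw [if_neg (by omega), mul_zero]
  · refine Finset.sum_eq_zero fun p hp => ?_
    rw [Finset.mem_range] at hp
    rw [if_neg (by omega), mul_zero]

theorem toeplitz_one (n : ℕ) : toeplitz n (1 : R⟦X⟧) = 1 := by
  ext i j
  simp only [toeplitz, Matrix.of_apply, Matrix.one_apply, coeff_one, Fin.ext_iff]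
  split_ifs <;> first | rfl | omega

theorem isUnit_toeplitz {n : ℕ} {e : R⟦X⟧} (he : IsUnit e) : IsUnit (toeplitz n e) := by
  obtain ⟨u, rfl⟩ := he
  exact ⟨⟨toeplitz n u, toeplitz n ↑u⁻¹, by rw [toeplitz_mul, u.mul_inv, toeplitz_one],
    by rw [toeplitz_mul, u.inv_mul, toeplitz_one]⟩, rfl⟩

variable [StarRing R]

theorem toeplitz_mul_of_mul_conjTranspose {n : ℕ} {e : R⟦X⟧}
    (hs : ∀ k, star (coeff k e) = coeff k e) (b : ℕ → ℕ → R) (i j : Fin n) :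
    (toeplitz n e * (Matrix.of fun i j : Fin n => b i j) * (toeplitz n e)ᴴ) i j =
      ∑ p ∈ Finset.range (i + 1), ∑ r ∈ Finset.range (j + 1),
        coeff (i - p) e * b p r * coeff (j - r) e := by
  have h (i : Fin n) (F : ℕ → R) : ∑ p : Fin n, F p * (toeplitz n e)ᴴ p i =
      ∑ p ∈ Finset.range (i + 1), F p * coeff (i - p) e := by
    have := congrArg star (sum_toeplitz_mul e (fun p => star (F p)) i)
    simpa [hs, Matrix.conjTranspose_apply] using this
  rw [mul_assoc, Matrix.mul_apply]
  simp only [Matrix.mul_apply, Matrix.of_apply]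
  simp only [fun p : ℕ => h j (b p)]
  rw [sum_toeplitz_mul e (fun p => ∑ r ∈ Finset.range (j + 1), b p r * coeff (j - r) e)]
  simp only [Finset.mul_sum, mul_assoc]

end Toeplitz

section BlockHankel

open PowerSeries

theorem posDef_comp_conj_iff {q n : ℕ} {T : Matrix (Fin n) (Fin n) (Mat q)} (hT : IsUnit T)
    (M : Matrix (Fin n) (Fin n) (Mat q)) :
    (comp _ _ _ _ _ (T * M * Tᴴ)).PosDef ↔ (comp _ _ _ _ _ M).PosDef := by
  have h := ((isUnit_comp_iff (M := T)).mpr hT).posDef_star_right_conjugate_iff (x := comp _ _ _ _ _ M)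
  rw [← h]
  have hmul (A B : Matrix (Fin n) (Fin n) (Mat q)) :
      comp _ _ _ _ _ (A * B) = comp _ _ _ _ _ A * comp _ _ _ _ _ B :=
    map_mul (compRingEquiv (Fin n) (Fin q) ℂ) A B
  rw [hmul, hmul]
  rfl

theorem posDef_fromBlocks_zero_iff {k l : Type*} [Fintype k] [Fintype l]
    {A : Matrix k k ℂ} {D : Matrix l l ℂ} :
    (fromBlocks A 0 0 D).PosDef ↔ A.PosDef ∧ D.PosDef := by
  refine ⟨fun h => ⟨?_, ?_⟩, fun ⟨hA, hD⟩ => ?_⟩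
  · exact h.submatrix (e := Sum.inl) Sum.inl_injective
  · exact h.submatrix (e := Sum.inr) Sum.inr_injective
  · refine .of_dotProduct_mulVec_pos (hA.1.fromBlocks (by simp) hD.1) fun x hx => ?_
    rw [← Sum.elim_comp_inl_inr x, fromBlocks_mulVec, Function.star_sumElim,
      sumElim_dotProduct_sumElim]
    simp only [Sum.elim_comp_inl, Sum.elim_comp_inr, zero_mulVec, add_zero, zero_add]
    have h1 := hA.posSemidef.dotProduct_mulVec_nonneg (x ∘ Sum.inl)
    have h2 := hD.posSemidef.dotProduct_mulVec_nonneg (x ∘ Sum.inr)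
    by_cases h : x ∘ Sum.inl = 0
    · refine add_pos_of_nonneg_of_pos h1 (hD.dotProduct_mulVec_pos fun h' => hx ?_)
      rw [← Sum.elim_comp_inl_inr x, h, h']
      exact Sum.elim_zero_zero
    · exact add_pos_of_pos_of_nonneg (hA.dotProduct_mulVec_pos h) h2

variable {q : ℕ} {e b : (Mat q)⟦X⟧} {c : Mat q}

theorem posDef_H2b_iff (he : e * (C c - X * b) = 1) (he' : (C c - X * b) * e = 1)
    (hs : ∀ k, (coeff k e).IsHermitian) (n : ℕ) :
    (H2b q (fun k => coeff k e) n).PosDef ↔ (H1b q (fun k => coeff k b) n).PosDef := by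
  have hT : IsUnit (toeplitz n e) := isUnit_toeplitz ⟨⟨_, _, he, he'⟩, rfl⟩
  rw [show H1b q (fun k => coeff k b) n = comp _ _ _ _ _ (of fun i j : Fin n =>
    coeff ((i : ℕ) + j) b) from rfl, ← posDef_comp_conj_iff hT]
  refine iff_of_eq (congrArg PosDef ?_)
  rw [show H2b q (fun k => coeff k e) n = comp _ _ _ _ _ (of fun i j : Fin n =>
    coeff ((i : ℕ) + j + 1) e) from rfl]
  refine congrArg _ (Matrix.ext fun i j => ?_)
  rw [toeplitz_mul_of_mul_conjTranspose hs fun i j => coeff (i + j) b,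
    sum_coeff_mul_coeff_mul_coeff he he']
  rfl

theorem posDef_H1b_succ_iff (he : e * (C c - X * b) = 1) (he' : (C c - X * b) * e = 1)
    (hs : ∀ k, (coeff k e).IsHermitian) (n : ℕ) :
    (H1b q (fun k => coeff k e) (n + 1)).PosDef ↔
      c.PosDef ∧ (H2b q (fun k => coeff k b) n).PosDef := by
  have hT : IsUnit (toeplitz (n + 1) e) := isUnit_toeplitz ⟨⟨_, _, he, he'⟩, rfl⟩
  let β : ℕ → ℕ → Mat q
    | 0, 0 => c
    | 0, _ + 1 => 0
    | _ + 1, 0 => 0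
    | i + 1, j + 1 => coeff (i + j + 1) b
  have h0 : c * constantCoeff e = 1 := by simpa using congrArg (coeff 0) he'
  have h0' : constantCoeff e * c = 1 := by simpa using congrArg (coeff 0) he
  have hβ : H1b q (fun k => coeff k e) (n + 1) = comp _ _ _ _ _
      (toeplitz (n + 1) e * (of fun i j : Fin (n + 1) => β i j) * (toeplitz (n + 1) e)ᴴ) := by
    rw [show H1b q (fun k => coeff k e) (n + 1) = comp _ _ _ _ _ (of fun i j : Fin (n + 1) =>
      coeff ((i : ℕ) + j) e) from rfl]
    refine congrArg _ (Matrix.ext fun i j => ?_)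
    rw [toeplitz_mul_of_mul_conjTranspose hs, of_apply]
    generalize (i : ℕ) = i
    generalize (j : ℕ) = j
    simp only [Finset.sum_range_succ', β, mul_zero, zero_mul, Finset.sum_const_zero, add_zero,
      zero_add, Nat.sub_zero]
    rcases i with _ | i
    · simp [h0']
    rcases j with _ | j
    · simp [mul_assoc, h0]
    simp only [Nat.reduceSubDiff]
    rw [add_comm (Finset.sum _ _), sum_coeff_mul_coeff_mul_coeff_succ he he']
    exact congrArg (coeff · e) (by ring)
  rw [hβ, posDef_comp_conj_iff hT, ← posDef_fromBlocks_zero_iff]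
  let φ : Fin q ⊕ (Fin n × Fin q) ≃ Fin (n + 1) × Fin q :=
    { toFun := Sum.elim (fun a => (0, a)) (fun p => (p.1.succ, p.2))
      invFun := fun p => Fin.cases (Sum.inl p.2) (fun i => Sum.inr (i, p.2)) p.1
      left_inv := by rintro (a | ⟨i, a⟩) <;> simp
      right_inv := by rintro ⟨i, a⟩; cases i using Fin.cases <;> simp }
  have hφ : (comp _ _ _ _ _ (of fun i j : Fin (n + 1) => β i j)).submatrix φ φ =
      fromBlocks c 0 0 (H2b q (fun k => coeff k b) n) := by
    ext (a | ⟨i, a⟩) (a' | ⟨j, a'⟩) <;> rfl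
  rw [← hφ]
  refine ⟨fun h => h.submatrix φ.injective, fun h => ?_⟩
  simpa using h.submatrix φ.symm.injective

/-- The first `n` terms of a sequence of matrices have positive definite block Hankel matrices,
both for the sequence itself and for its shift. -/
def IsStieltjesPos (q n : ℕ) (s : ℕ → Mat q) : Prop :=
  (H1b q s ((n + 1) / 2)).PosDef ∧ (H2b q s (n / 2)).PosDef

theorem isStieltjesPos_zero (s : ℕ → Mat q) : IsStieltjesPos q 0 s := by
  have h (M : Matrix (Fin 0 × Fin q) (Fin 0 × Fin q) ℂ) : M.PosDef :=
    .of_dotProduct_mulVec_pos (Subsingleton.elim _ _) fun x hx =>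
      (hx (Subsingleton.elim _ _)).elim
  exact ⟨h _, h _⟩

theorem isStieltjesPos_succ_iff (he : e * (C c - X * b) = 1) (he' : (C c - X * b) * e = 1)
    (hs : ∀ k, (coeff k e).IsHermitian) (n : ℕ) :
    IsStieltjesPos q (n + 1) (fun k => coeff k e) ↔
      c.PosDef ∧ IsStieltjesPos q n (fun k => coeff k b) := by
  simp only [IsStieltjesPos]
  rw [show (n + 1 + 1) / 2 = n / 2 + 1 by omega, posDef_H1b_succ_iff he he' hs,
    posDef_H2b_iff he he' hs]
  tauto

theorem IsStieltjesPos.posDef_zero {n : ℕ} {s : ℕ → Mat q} (h : IsStieltjesPos q (n + 1) s) :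
    (s 0).PosDef := by
  have h1 := h.1
  rw [show (n + 1 + 1) / 2 = n / 2 + 1 by omega] at h1
  exact h1.submatrix (e := fun a => (0, a)) fun a a' h => (Prod.ext_iff.mp h).2

end BlockHankel

section ContinuedFraction

open PowerSeries

theorem coe_sub_ring {R : Type*} [Ring R] (p p' : Polynomial R) :
    ((p - p' : Polynomial R) : R⟦X⟧) = p - p' := by
  ext k
  simp

theorem X_pow_succ_dvd_X_mul_iff {R : Type*} [Ring R] {n : ℕ} {f : R⟦X⟧} :
    X ^ (n + 1) ∣ X * f ↔ X ^ n ∣ f := by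
  refine ⟨fun h => X_pow_dvd_iff.mpr fun k hk => ?_, fun h => pow_succ' (X : R⟦X⟧) n ▸
    mul_dvd_mul_left X h⟩
  simpa [coeff_succ_X_mul] using X_pow_dvd_iff.mp h (k + 1) (by omega)

theorem exists_mul_sub_X_mul_eq_one {R : Type*} [Ring R] {e : R⟦X⟧}
    (he : IsUnit (constantCoeff e)) :
    ∃ (c : R) (b : R⟦X⟧), e * (C c - X * b) = 1 ∧ (C c - X * b) * e = 1 := by
  obtain ⟨u, hu⟩ := isUnit_iff_constantCoeff.mpr he
  have h : C (coeff 0 (↑u⁻¹ : R⟦X⟧)) - X * PowerSeries.mk (fun k => -coeff (k + 1) (↑u⁻¹ : R⟦X⟧)) =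
      (↑u⁻¹ : R⟦X⟧) := by
    ext (_ | k)
    · simp
    · simp [coeff_succ_X_mul]
  exact ⟨_, _, by rw [h, ← hu, u.mul_inv], by rw [h, ← hu, u.inv_mul]⟩

theorem star_coeff_of_mul_eq_one {R : Type*} [Ring R] [StarRing R] {e g : R⟦X⟧}
    (he : ∀ k, star (coeff k e) = coeff k e) (h : e * g = 1) (k : ℕ) :
    star (coeff k g) = coeff k g := by
  have h1 : PowerSeries.mk (fun k => star (coeff k g)) * e = 1 := by
    ext k
    have := congrArg star (congrArg (coeff k) h)
    rw [coeff_mul, star_sum, ← Finset.Nat.sum_antidiagonal_swap] at this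
    simp only [star_mul, Prod.fst_swap, Prod.snd_swap, he] at this
    rw [coeff_mul]
    simp only [coeff_mk]
    rw [this, coeff_one]
    split_ifs <;> simp
  have h2 : PowerSeries.mk (fun k => star (coeff k g)) = g := left_inv_eq_right_inv h1 h
  simpa using congrArg (coeff k) h2

/-- Denominator and numerator (`e = den⁻¹ * num`) of the continued fraction
`e = (κ 0 - X * (κ 1 - X * (⋯ - X * (κ (n - 1))⁻¹)⁻¹)⁻¹)⁻¹`. -/
def stieltjesFrac {R : Type*} [Ring R] :
    ℕ → (ℕ → R) → Polynomial R × Polynomial R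
  | 0, _ => (1, 0)
  | n + 1, κ =>
    ((stieltjesFrac n fun k => κ (k + 1)).1 * Polynomial.C (κ 0) -
      Polynomial.X * (stieltjesFrac n fun k => κ (k + 1)).2,
      (stieltjesFrac n fun k => κ (k + 1)).1)

theorem natDegree_stieltjesFrac {R : Type*} [Ring R] (n : ℕ) (κ : ℕ → R) :
    (stieltjesFrac n κ).1.natDegree ≤ n / 2 ∧ (stieltjesFrac n κ).2.natDegree ≤ (n - 1) / 2 := by
  induction n generalizing κ with
  | zero => simp [stieltjesFrac]
  | succ n ih =>
    obtain ⟨h1, h2⟩ := ih fun k => κ (k + 1)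
    refine ⟨?_, by simpa [stieltjesFrac] using h1⟩
    rw [stieltjesFrac]
    refine (Polynomial.natDegree_sub_le _ _).trans (max_le ?_ ?_)
    · exact (Polynomial.natDegree_mul_C_le _ _).trans (by omega)
    · rcases n with _ | n
      · simp [stieltjesFrac]
      · exact Polynomial.natDegree_mul_le.trans
          ((add_le_add Polynomial.natDegree_X_le h2).trans (by omega))

theorem isUnit_coeff_zero_stieltjesFrac {R : Type*} [Ring R] {n : ℕ} {κ : ℕ → R}
    (hκ : ∀ k < n, IsUnit (κ k)) : IsUnit ((stieltjesFrac n κ).1.coeff 0) := by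
  induction n generalizing κ with
  | zero => simp [stieltjesFrac]
  | succ n ih =>
    have h := ih (κ := fun k => κ (k + 1)) fun k hk => hκ _ (by omega)
    simpa [stieltjesFrac] using h.mul (hκ 0 (by omega))

theorem posDef_of_mul_eq_one {q : ℕ} {a b : Mat q} (ha : a.PosDef) (h : a * b = 1) :
    b.PosDef := by
  rw [← inv_eq_right_inv h]
  exact ha.inv

/-- A sequence of Hermitian matrices has positive definite block Hankel matrices if and only if
its generating function is approximated by a continued fraction with positive definite
parameters. -/
theorem isStieltjesPos_iff_exists_stieltjesFrac {q : ℕ} (n : ℕ) (e : (Mat q)⟦X⟧)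
    (hs : ∀ k, (coeff k e).IsHermitian) :
    IsStieltjesPos q n (fun k => coeff k e) ↔ ∃ κ : ℕ → Mat q, (∀ k < n, (κ k).PosDef) ∧
      X ^ n ∣ ((stieltjesFrac n κ).1 : (Mat q)⟦X⟧) * e - ((stieltjesFrac n κ).2 : (Mat q)⟦X⟧) := by
  induction n generalizing e with
  | zero => exact iff_of_true (isStieltjesPos_zero _) ⟨0, by simp⟩
  | succ n ih =>
    have key (c b) (he : e * (C c - X * b) = 1) (he' : (C c - X * b) * e = 1) (κ : ℕ → Mat q)
        (hκ : κ 0 = c) :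
        X ^ (n + 1) ∣ ((stieltjesFrac (n + 1) κ).1 : (Mat q)⟦X⟧) * e -
          ((stieltjesFrac (n + 1) κ).2 : (Mat q)⟦X⟧) ↔
        X ^ n ∣ ((stieltjesFrac n fun k => κ (k + 1)).1 : (Mat q)⟦X⟧) * b -
          ((stieltjesFrac n fun k => κ (k + 1)).2 : (Mat q)⟦X⟧) := by
      have hu : IsUnit e := ⟨⟨_, _, he, he'⟩, rfl⟩
      set P := ((stieltjesFrac n fun k => κ (k + 1)).1 : (Mat q)⟦X⟧)
      set Q := ((stieltjesFrac n fun k => κ (k + 1)).2 : (Mat q)⟦X⟧)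
      have h : ((stieltjesFrac (n + 1) κ).1 : (Mat q)⟦X⟧) * e -
          ((stieltjesFrac (n + 1) κ).2 : (Mat q)⟦X⟧) = X * ((P * b - Q) * e) := by
        have h1 : ((stieltjesFrac (n + 1) κ).1 : (Mat q)⟦X⟧) = P * C c - X * Q := by
          simp [stieltjesFrac, P, Q, hκ, coe_sub_ring]
        have h2 : ((stieltjesFrac (n + 1) κ).2 : (Mat q)⟦X⟧) = P := rfl
        rw [h1, h2]
        calc (P * C c - X * Q) * e - P = (P * C c - X * Q) * e - P * ((C c - X * b) * e) := by
              rw [he', mul_one]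
          _ = (P * X) * b * e - X * Q * e := by noncomm_ring
          _ = X * ((P * b - Q) * e) := by rw [(commute_X P).eq]; noncomm_ring
      rw [h, X_pow_succ_dvd_X_mul_iff]
      obtain ⟨u, rfl⟩ := hu
      exact u.dvd_mul_right
    constructor
    · intro h
      have h0 : (coeff 0 e).PosDef := h.posDef_zero
      obtain ⟨c, b, he, he'⟩ := exists_mul_sub_X_mul_eq_one (e := e) (by simpa using h0.isUnit)
      have hg := star_coeff_of_mul_eq_one hs he
      have hb (k : ℕ) : (coeff k b).IsHermitian := by
        simpa [coeff_C, coeff_succ_X_mul, star_eq_conjTranspose] using! hg (k + 1)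
      obtain ⟨hc, h'⟩ := (isStieltjesPos_succ_iff he he' hs n).mp h
      obtain ⟨κ, hκ, hdvd⟩ := (ih b hb).mp h'
      refine ⟨fun k => Nat.casesOn k c κ, fun k hk => ?_, ?_⟩
      · rcases k with _ | k
        · exact hc
        · exact hκ k (by omega)
      · exact (key c b he he' _ rfl).mpr hdvd
    · rintro ⟨κ, hκ, hdvd⟩
      have hP : IsUnit ((stieltjesFrac n fun k => κ (k + 1)).1.coeff 0) :=
        isUnit_coeff_zero_stieltjesFrac fun k hk => (hκ (k + 1) (by omega)).isUnit
      have h0 : κ 0 * constantCoeff e = 1 := by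
        have := (X_pow_dvd_iff.mp hdvd) 0 n.succ_pos
        simp [stieltjesFrac, sub_eq_zero, mul_assoc] at this
        exact hP.mul_left_cancel (by simpa using this)
      have hU : IsUnit (constantCoeff e) :=
        (posDef_of_mul_eq_one (hκ 0 n.succ_pos) h0).isUnit
      obtain ⟨c, b, he, he'⟩ := exists_mul_sub_X_mul_eq_one (e := e) hU
      have hg := star_coeff_of_mul_eq_one hs he
      have hb (k : ℕ) : (coeff k b).IsHermitian := by
        simpa [coeff_C, coeff_succ_X_mul, star_eq_conjTranspose] using! hg (k + 1)
      have hc : κ 0 = c := left_inv_eq_right_inv h0 (by simpa using congrArg (coeff 0) he)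
      refine (isStieltjesPos_succ_iff he he' hs n).mpr ⟨hc ▸ hκ 0 n.succ_pos,
        (ih b hb).mpr ⟨_, fun k hk => hκ (k + 1) (by omega), (key c b he he' κ hc).mp hdvd⟩⟩

end ContinuedFraction

section ScalarEval

open Polynomial

variable {q : ℕ}

/-- Evaluation of a polynomial with matrix coefficients at a scalar. -/
def scalarEval (x : ℂ) : (Mat q)[X] →+* Mat q :=
  eval₂RingHom' (RingHom.id _) (Matrix.scalar (Fin q) x) fun a =>
    (Matrix.scalar_commute x (fun r => mul_comm x r) a).symm

theorem scalarEval_C (x : ℂ) (a : Mat q) : scalarEval x (C a) = a :=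
  eval₂_C _ _

theorem scalarEval_X_mul (x : ℂ) (p : (Mat q)[X]) :
    scalarEval x (X * p) = x • scalarEval x p := by
  rw [map_mul, show scalarEval x (X : (Mat q)[X]) = Matrix.scalar (Fin q) x from eval₂_X _ _]
  ext i j
  simp [Matrix.scalar_apply]

theorem scalarEval_X_pow_mul (x : ℂ) (n : ℕ) (p : (Mat q)[X]) :
    scalarEval x (X ^ n * p) = x ^ n • scalarEval x p := by
  induction n with
  | zero => simp
  | succ n ih => rw [pow_succ', mul_assoc, scalarEval_X_mul, ih, smul_smul, pow_succ']

theorem scalarEval_matPolyEquiv (x : ℂ) (M : Matrix (Fin q) (Fin q) ℂ[X]) (i j : Fin q) :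
    scalarEval x (matPolyEquiv M) i j = (M i j).eval x :=
  matPolyEquiv_eval M x i j

theorem eq_of_infinite_scalarEval_eq {p p' : (Mat q)[X]} {S : Set ℂ} (hS : S.Infinite)
    (h : ∀ x ∈ S, scalarEval x p = scalarEval x p') : p = p' := by
  apply matPolyEquiv.symm.injective
  ext1 i j
  refine eq_of_infinite_eval_eq _ _ (hS.mono fun x hx => ?_)
  simp only [Set.mem_ofPred_eq, ← scalarEval_matPolyEquiv, AlgEquiv.apply_symm_apply, h x hx]

theorem finite_det_scalarEval_eq_zero {p : (Mat q)[X]} (hp : (p.coeff 0).det ≠ 0) :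
    {x | (scalarEval x p).det = 0}.Finite := by
  have h (x : ℂ) : (scalarEval x p).det = (matPolyEquiv.symm p).det.eval x := by
    rw [_root_.eval_det, AlgEquiv.apply_symm_apply]
    rfl
  have h0 : scalarEval 0 p = p.coeff 0 := by
    change eval₂ _ _ p = _
    rw [map_zero, eval₂_at_zero]
    rfl
  have hne : (matPolyEquiv.symm p).det ≠ 0 := fun h' => hp (by rw [← h0, h, h', eval_zero])
  simpa only [h] using! finite_setOfPred_isRoot hne

/-- The polynomial `∑ j ≤ n, (-1) ^ j a_j X ^ j`, which encodes `∑ j ≤ n, z ^ (n - j) a_j`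
in the variable `-z⁻¹`. -/
def altReverse (n : ℕ) (a : ℕ → Mat q) : (Mat q)[X] :=
  ∑ j ∈ Finset.range (n + 1), X ^ j * C ((-1 : ℂ) ^ j • a j)

theorem coeff_altReverse (n : ℕ) (a : ℕ → Mat q) (k : ℕ) :
    (altReverse n a).coeff k = if k ≤ n then (-1 : ℂ) ^ k • a k else 0 := by
  simp [altReverse]

theorem natDegree_altReverse_le (n : ℕ) (a : ℕ → Mat q) : (altReverse n a).natDegree ≤ n := by
  rw [natDegree_le_iff_coeff_eq_zero]
  intro k hk
  rw [coeff_altReverse, if_neg (by omega)]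

theorem sum_pow_smul_eq_smul_scalarEval {z : ℂ} (hz : z ≠ 0) (n : ℕ) (a : ℕ → Mat q) :
    ∑ j ∈ Finset.range (n + 1), z ^ (n - j) • a j =
      z ^ n • scalarEval (-z⁻¹) (altReverse n a) := by
  rw [altReverse, map_sum, Finset.smul_sum]
  refine Finset.sum_congr rfl fun j hj => ?_
  rw [scalarEval_X_pow_mul, scalarEval_C, smul_smul, smul_smul, pow_sub₀ _ hz
    (Nat.lt_succ_iff.mp (Finset.mem_range.mp hj)), mul_assoc, ← mul_pow]
  simp

theorem gOdd_eq {z : ℂ} (hz : z ≠ 0) (m : ℕ) (A : ℕ → Mat q) :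
    gOdd q m A z = z ^ m • scalarEval (-z⁻¹) (altReverse m fun j => A (2 * j)) :=
  sum_pow_smul_eq_smul_scalarEval hz m fun j => A (2 * j)

theorem hOdd_eq {z : ℂ} (hz : z ≠ 0) (m : ℕ) (A : ℕ → Mat q) :
    hOdd q m A z = z ^ m • scalarEval (-z⁻¹) (altReverse m fun j => A (2 * j + 1)) :=
  sum_pow_smul_eq_smul_scalarEval hz m fun j => A (2 * j + 1)

theorem MarkovOdd.exists_eq {m : ℕ} {A s : ℕ → Mat q} (h : MarkovOdd q m A s) :
    ∃ r : (Mat q)[X], altReverse (2 * m) (fun j => (-1 : ℂ) ^ j • s j) *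
        altReverse m (fun j => A (2 * j)) =
      altReverse m (fun j => A (2 * j + 1)) + X ^ (2 * m + 1) * r := by
  obtain ⟨B, hB⟩ := h
  refine ⟨altReverse m fun j => B (m - j), eq_of_infinite_scalarEval_eq
    (Set.Infinite.sdiff Set.infinite_univ (Set.finite_singleton (0 : ℂ))) ?_⟩
  rintro x ⟨-, hx⟩
  obtain ⟨z, hz, rfl⟩ : ∃ z : ℂ, z ≠ 0 ∧ x = -z⁻¹ :=
    ⟨-x⁻¹, by simpa using hx, by simp⟩
  have h1 := hB z
  have h2 := sum_pow_smul_eq_smul_scalarEval hz m fun j => B (m - j)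
  have h3 := sum_pow_smul_eq_smul_scalarEval hz (2 * m) fun j => (-1 : ℂ) ^ j • s j
  have h2' : ∑ k ∈ Finset.range (m + 1), z ^ k • B k =
      z ^ m • scalarEval (-z⁻¹) (altReverse m fun j => B (m - j)) := by
    rw [← h2, ← Finset.sum_range_reflect]
    exact Finset.sum_congr rfl fun j hj => by simp
  simp only [smul_smul, mul_comm (z ^ _)] at h3
  rw [h2', h3, hOdd_eq hz, gOdd_eq hz] at h1
  rw [map_mul, map_add, scalarEval_X_pow_mul]
  generalize scalarEval (-z⁻¹) (altReverse m fun j => A (2 * j + 1)) = H at *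
  generalize scalarEval (-z⁻¹) (altReverse m fun j => A (2 * j)) = G at *
  generalize scalarEval (-z⁻¹) (altReverse m fun j => B (m - j)) = K at *
  generalize scalarEval (-z⁻¹) (altReverse (2 * m) fun j => (-1 : ℂ) ^ j • s j) = S at *
  have h4 : z ^ (3 * m + 1) • (S * G) = z ^ (3 * m + 1) • H - z ^ m • K := by
    rw [← h1, Matrix.smul_mul, Matrix.mul_smul, Matrix.mul_smul]
    simp only [smul_smul]
    rw [← pow_add, ← mul_assoc, ← pow_succ, ← pow_add, show 2 * m + 1 + m = 3 * m + 1 by ring,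
      sub_sub_cancel]
  have h5 : z ^ (3 * m + 1) ≠ 0 := pow_ne_zero _ hz
  rw [← smul_right_inj h5, h4, smul_add, smul_smul, sub_eq_add_neg, ← neg_smul]
  congr 2
  rw [Odd.neg_pow ⟨m, rfl⟩, show 3 * m + 1 = m + (2 * m + 1) by ring, pow_add, inv_pow]
  field_simp

end ScalarEval

section Continued

open Polynomial

variable {q : ℕ}

/-- At `x` the continued fraction with entries `κ` has an invertible denominator and value `E`. -/
def HasStieltjesValue (x : ℂ) (n : ℕ) (κ : ℕ → Mat q) (E : Mat q) : Prop :=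
  IsUnit (scalarEval x (stieltjesFrac n κ).1) ∧
    scalarEval x (stieltjesFrac n κ).1 * E = scalarEval x (stieltjesFrac n κ).2

theorem HasStieltjesValue.zero (x : ℂ) (κ : ℕ → Mat q) : HasStieltjesValue x 0 κ 0 := by
  simp [HasStieltjesValue, stieltjesFrac]

theorem HasStieltjesValue.succ {x : ℂ} {n : ℕ} {κ : ℕ → Mat q} {E : Mat q}
    (h : HasStieltjesValue x n (fun k => κ (k + 1)) E) (hu : IsUnit (κ 0 - x • E)) :
    HasStieltjesValue x (n + 1) κ (κ 0 - x • E)⁻¹ := by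
  have key : scalarEval x (stieltjesFrac (n + 1) κ).1 =
      scalarEval x (stieltjesFrac n fun k => κ (k + 1)).1 * (κ 0 - x • E) := by
    rw [stieltjesFrac, map_sub, map_mul, scalarEval_C, scalarEval_X_mul, ← h.2, mul_sub,
      Matrix.mul_smul]
  refine ⟨key ▸ h.1.mul hu, ?_⟩
  rw [key, mul_assoc, Matrix.mul_nonsing_inv _ ((Matrix.isUnit_iff_isUnit_det _).1 hu), mul_one]
  rfl

/-- The entries `c 0, d 0, c 1, d 1, …`. -/
def interleave (c d : ℕ → Mat q) (k : ℕ) : Mat q :=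
  if Even k then c (k / 2) else d (k / 2)

theorem interleave_two_mul (c d : ℕ → Mat q) (k : ℕ) : interleave c d (2 * k) = c k := by
  simp [interleave]

theorem interleave_two_mul_add_one (c d : ℕ → Mat q) (k : ℕ) :
    interleave c d (2 * k + 1) = d k := by
  simp [interleave, Nat.not_even_bit1]
  congr; omega

theorem inv_smul_of_ne_zero {z : ℂ} (hz : z ≠ 0) {w : Mat q} (hw : IsUnit w) :
    (z⁻¹ • w)⁻¹ = z • w⁻¹ := by
  refine Matrix.inv_eq_right_inv ?_
  rw [Matrix.smul_mul, Matrix.mul_smul, smul_smul, inv_mul_cancel₀ hz, one_smul,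
    Matrix.mul_nonsing_inv _ ((Matrix.isUnit_iff_isUnit_det _).1 hw)]

theorem HasStieltjesValue.add_two {z : ℂ} (hz : z ≠ 0) {n : ℕ} {κ : ℕ → Mat q} {E w : Mat q}
    (h : HasStieltjesValue (-z⁻¹) n (fun k => κ (k + 2)) E) (hu : IsUnit (κ 1 + z⁻¹ • E))
    (hw : w = z • κ 0 + (κ 1 + z⁻¹ • E)⁻¹) (hwu : IsUnit w) :
    HasStieltjesValue (-z⁻¹) (n + 2) κ (z • w⁻¹) := by
  have h1 : HasStieltjesValue (-z⁻¹) (n + 1) (fun k => κ (k + 1)) (κ 1 + z⁻¹ • E)⁻¹ := by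
    have := HasStieltjesValue.succ (κ := fun k => κ (k + 1)) h
      (by rw [neg_smul, sub_neg_eq_add]; exact hu)
    rwa [neg_smul, sub_neg_eq_add] at this
  have h2 : κ 0 - (-z⁻¹) • (κ 1 + z⁻¹ • E)⁻¹ = z⁻¹ • w := by
    rw [hw, smul_add, smul_smul, inv_mul_cancel₀ hz, one_smul, neg_smul, sub_neg_eq_add]
  have h3 : IsUnit (z⁻¹ • w) := by
    rw [Matrix.isUnit_iff_isUnit_det] at hwu ⊢
    rw [Matrix.det_smul]
    exact (IsUnit.mk0 _ (pow_ne_zero _ (inv_ne_zero hz))).mul hwu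
  have := h1.succ (by rw [h2]; exact h3)
  rwa [h2, inv_smul_of_ne_zero hz hwu] at this

theorem hasStieltjesValue_wOdd {m : ℕ} {c d : ℕ → Mat q} {z : ℂ} (hz : z ≠ 0)
    (hc : IsUnit (c m)) (hd : IsUnit (d (m - 1) + z⁻¹ • (c m)⁻¹).det)
    (hw : ∀ j < m, IsUnit (wOdd q m c d j z).det)
    (hdw : ∀ j, j + 1 < m → IsUnit (d (m - 2 - j) + (wOdd q m c d j z)⁻¹).det) {j : ℕ}
    (hj : j < m) :
    HasStieltjesValue (-z⁻¹) (2 * j + 3) (fun k => interleave c d (2 * (m - 1 - j) + k))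
      (z • (wOdd q m c d j z)⁻¹) := by
  simp only [← Matrix.isUnit_iff_isUnit_det] at hd hw hdw
  have e0 (k : ℕ) : interleave c d (2 * k + 0) = c k := interleave_two_mul c d k
  induction j with
  | zero =>
    refine HasStieltjesValue.add_two (n := 1) (E := (c m)⁻¹) hz ?_ ?_ ?_ (hw 0 hj)
    · have e2 : interleave c d (2 * (m - 1 - 0) + (0 + 2)) = c m := by
        rw [← interleave_two_mul c d m]
        congr 1
        omega
      have := HasStieltjesValue.succ
        (κ := fun k => interleave c d (2 * (m - 1 - 0) + (k + 2))) (.zero (-z⁻¹) _)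
      simp only [smul_zero, sub_zero, e2] at this
      exact this hc
    · simp only [interleave_two_mul_add_one]
      exact hd
    · simp only [interleave_two_mul_add_one, e0]
      rfl
  | succ j ih =>
    have ih := ih (by omega)
    have e : m - 1 - (j + 1) = m - 2 - j := by omega
    have e' : (z⁻¹ • z • (wOdd q m c d j z)⁻¹) = (wOdd q m c d j z)⁻¹ := by
      rw [smul_smul, inv_mul_cancel₀ hz, one_smul]
    rw [e]
    refine HasStieltjesValue.add_two (n := 2 * j + 3) (E := z • (wOdd q m c d j z)⁻¹)
      hz ?_ ?_ ?_ (hw (j + 1) hj)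
    · convert ih using 3 with k
      omega
    · simp only [interleave_two_mul_add_one, e']
      exact hdw j hj
    · simp only [interleave_two_mul_add_one, e0, e']
      rfl

end Continued

section Markov

open Polynomial
open scoped PowerSeries

variable {q m : ℕ} {A s : ℕ → Mat q}

theorem coeff_altReverse_neg_one_pow_smul (k : ℕ) :
    (altReverse (2 * m) fun j => (-1 : ℂ) ^ j • s j).coeff k = if k ≤ 2 * m then s k else 0 := by
  rw [coeff_altReverse, smul_smul, ← mul_pow]
  simp

theorem isStieltjesPos_iff_posDef :
    IsStieltjesPos q (2 * m + 1) (fun k => PowerSeries.coeff k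
        ((altReverse (2 * m) fun j => (-1 : ℂ) ^ j • s j : (Mat q)[X]) : (Mat q)⟦X⟧)) ↔
      (H1b q s (m + 1)).PosDef ∧ (H2b q s m).PosDef := by
  rw [IsStieltjesPos, show (2 * m + 1 + 1) / 2 = m + 1 by omega, show (2 * m + 1) / 2 = m by omega]
  simp only [coeff_coe, coeff_altReverse_neg_one_pow_smul]
  have h1 : H1b q (fun k => if k ≤ 2 * m then s k else 0) (m + 1) = H1b q s (m + 1) := by
    ext i j
    have hi := i.1.2
    have hj := j.1.2
    rw [H1b, of_apply, if_pos (by omega)]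
    rfl
  have h2 : H2b q (fun k => if k ≤ 2 * m then s k else 0) m = H2b q s m := by
    ext i j
    have hi := i.1.2
    have hj := j.1.2
    rw [H2b, of_apply, if_pos (by omega)]
    rfl
  rw [h1, h2]

theorem X_pow_dvd_coe_sub_iff {R : Type*} [Ring R] {N : ℕ} {e G H r D D' : R[X]}
    (hG : G.coeff 0 = 1) (he : e * G = H + X ^ N * r)
    (hH : (D * H).natDegree < N) (hD' : (D' * G).natDegree < N) :
    (PowerSeries.X : R⟦X⟧) ^ N ∣ (D : R⟦X⟧) * e - D' ↔ D * H = D' * G := by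
  have key : (D * e - D') * G = D * H - D' * G + X ^ N * (D * r) := by
    rw [sub_mul, mul_assoc, he, mul_add, ← mul_assoc D, ← mul_assoc (X ^ N), X_pow_mul]
    abel
  have hu : IsUnit (G : R⟦X⟧) := by
    rw [PowerSeries.isUnit_iff_constantCoeff, ← PowerSeries.coeff_zero_eq_constantCoeff_apply,
      coeff_coe, hG]
    exact isUnit_one
  have h : (PowerSeries.X : R⟦X⟧) ^ N ∣ (D : R⟦X⟧) * e - D' ↔
      (PowerSeries.X : R⟦X⟧) ^ N ∣ ((D * H - D' * G : R[X]) : R⟦X⟧) := by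
    rw [← hu.dvd_mul_right, ← coe_mul, ← coe_sub_ring, ← coe_mul, key, coe_add, coe_mul, coe_pow,
      coe_X]
    exact (dvd_add_left (dvd_mul_right _ _))
  rw [h, PowerSeries.X_pow_dvd_iff, ← sub_eq_zero]
  constructor
  · intro h
    ext k
    rcases lt_or_ge k N with hk | hk
    · simpa using h k hk
    · exact coeff_eq_zero_of_natDegree_lt
        (((natDegree_sub_le _ _).trans_lt (max_lt hH hD')).trans_le hk)
  · intro h k _
    rw [h]
    simp

theorem MarkovOdd.X_pow_dvd_iff (hM : MarkovOdd q m A s) (hA : A 0 = 1) (κ : ℕ → Mat q) :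
    (PowerSeries.X : (Mat q)⟦X⟧) ^ (2 * m + 1) ∣ ((stieltjesFrac (2 * m + 1) κ).1 : (Mat q)⟦X⟧) *
        ((altReverse (2 * m) fun j => (-1 : ℂ) ^ j • s j : (Mat q)[X]) : (Mat q)⟦X⟧) -
          ((stieltjesFrac (2 * m + 1) κ).2 : (Mat q)⟦X⟧) ↔
      (stieltjesFrac (2 * m + 1) κ).1 * altReverse m (fun j => A (2 * j + 1)) =
        (stieltjesFrac (2 * m + 1) κ).2 * altReverse m (fun j => A (2 * j)) := by
  obtain ⟨r, hr⟩ := hM.exists_eq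
  have h1 := natDegree_stieltjesFrac (2 * m + 1) κ
  refine X_pow_dvd_coe_sub_iff (by simp [coeff_altReverse, hA]) hr ?_ ?_
  · exact natDegree_mul_le.trans_lt
      ((add_le_add h1.1 (natDegree_altReverse_le _ _)).trans_lt (by omega))
  · exact natDegree_mul_le.trans_lt
      ((add_le_add h1.2 (natDegree_altReverse_le _ _)).trans_lt (by omega))

theorem posDef_wOdd {c d : ℕ → Mat q} (hc : ∀ k ≤ m, (c k).PosDef) (hd : ∀ k < m, (d k).PosDef)
    {z : ℂ} (hz : 0 < z) {j : ℕ} (hj : j < m) : (wOdd q m c d j z).PosDef := by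
  induction j with
  | zero =>
    exact ((hc _ (by omega)).smul hz).add
      ((hd _ (by omega)).add ((hc m le_rfl).inv.smul (RCLike.inv_pos_of_pos hz))).inv
  | succ j ih =>
    exact ((hc _ (by omega)).smul hz).add ((hd _ (by omega)).add (ih (by omega)).inv).inv

/-- The value of the continued fraction at the top level. -/
theorem hasStieltjesValue_wOdd_last {c d : ℕ → Mat q} {z : ℂ} (hm : 1 ≤ m) (hz : z ≠ 0)
    (hc : IsUnit (c m)) (hd : IsUnit (d (m - 1) + z⁻¹ • (c m)⁻¹).det)
    (hw : ∀ j < m, IsUnit (wOdd q m c d j z).det)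
    (hdw : ∀ j, j + 1 < m → IsUnit (d (m - 2 - j) + (wOdd q m c d j z)⁻¹).det) :
    HasStieltjesValue (-z⁻¹) (2 * m + 1) (interleave c d) (z • (wOdd q m c d (m - 1) z)⁻¹) := by
  have := hasStieltjesValue_wOdd hz hc hd hw hdw (j := m - 1) (by omega)
  simpa [show 2 * (m - 1) + 3 = 2 * m + 1 by omega] using this

theorem IsHTMOdd.exists_posDef (hm : 1 ≤ m) (hA : A 0 = 1)
    (h : IsHTMOdd q m (hOdd q m A) (gOdd q m A)) :
    ∃ κ : ℕ → Mat q, (∀ k < 2 * m + 1, (κ k).PosDef) ∧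
      (stieltjesFrac (2 * m + 1) κ).1 * altReverse m (fun j => A (2 * j + 1)) =
        (stieltjesFrac (2 * m + 1) κ).2 * altReverse m (fun j => A (2 * j)) := by
  obtain ⟨c, d, hc, hd, h⟩ := h
  refine ⟨interleave c d, fun k hk => ?_, ?_⟩
  · rcases Nat.even_or_odd' k with ⟨l, rfl | rfl⟩
    · rw [interleave_two_mul]
      exact hc l (by omega)
    · rw [interleave_two_mul_add_one]
      exact hd l (by omega)
  have hS : ((fun t : ℝ => (-(t : ℂ)⁻¹)) '' Set.Ioi 0).Infinite := by
    refine Set.Infinite.image (fun a _ b _ hab => ?_) (Set.Ioi_infinite 0)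
    simpa using hab
  have hfin : {x | (scalarEval x (altReverse m fun j => A (2 * j))).det = 0}.Finite :=
    finite_det_scalarEval_eq_zero (by simp [coeff_altReverse, hA])
  refine eq_of_infinite_scalarEval_eq (hS.sdiff hfin) ?_
  rintro _ ⟨⟨t, ht, rfl⟩, hx⟩
  simp only [Set.mem_ofPred_eq] at hx ⊢
  have hz : (0 : ℂ) < t := by simpa using ht
  have hz0 := hz.ne'
  generalize (t : ℂ) = z at *
  have hu {M : Mat q} (hM : M.PosDef) : IsUnit M.det := (isUnit_iff_isUnit_det _).1 hM.isUnit
  have hg : IsUnit (gOdd q m A z).det := by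
    rw [gOdd_eq hz0, det_smul]
    exact (IsUnit.mk0 _ (pow_ne_zero _ (pow_ne_zero _ hz0))).mul (IsUnit.mk0 _ hx)
  have h1 := hu ((hd (m - 1) (by omega)).add
    ((hc m le_rfl).inv.smul (RCLike.inv_pos_of_pos hz)))
  have h2 (j) (hj : j < m) := hu (posDef_wOdd hc hd hz hj)
  have h3 (j) (hj : j + 1 < m) := hu ((hd (m - 2 - j) (by omega)).add
    (posDef_wOdd hc hd hz (j := j) (by omega)).inv)
  have h4 := h z hz0 hg.ne_zero h1 h2 h3
  have h5 := hasStieltjesValue_wOdd_last hm hz0 (hc m le_rfl).isUnit h1 h2 h3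
  have h6 : hOdd q m A z = (z • (wOdd q m c d (m - 1) z)⁻¹) * gOdd q m A z := by
    have hg' : IsUnit (z • gOdd q m A z).det := by
      rw [det_smul]
      exact (IsUnit.mk0 _ (pow_ne_zero _ hz0)).mul hg
    rw [← h4, smul_mul_assoc, ← mul_smul_comm, nonsing_inv_mul_cancel_right _ _ hg']
  rw [hOdd_eq hz0, gOdd_eq hz0, mul_smul_comm] at h6
  rw [map_mul, map_mul, smul_right_injective _ (pow_ne_zero m hz0) h6, ← mul_assoc, h5.2]

theorem IsHTMOdd.of_posDef (hm : 1 ≤ m) {κ : ℕ → Mat q} (hκ : ∀ k < 2 * m + 1, (κ k).PosDef)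
    (h : (stieltjesFrac (2 * m + 1) κ).1 * altReverse m (fun j => A (2 * j + 1)) =
        (stieltjesFrac (2 * m + 1) κ).2 * altReverse m (fun j => A (2 * j))) :
    IsHTMOdd q m (hOdd q m A) (gOdd q m A) := by
  have hκ' : interleave (fun k => κ (2 * k)) (fun k => κ (2 * k + 1)) = κ := by
    funext k
    rcases Nat.even_or_odd' k with ⟨l, rfl | rfl⟩
    · rw [interleave_two_mul]
    · rw [interleave_two_mul_add_one]
  refine ⟨fun k => κ (2 * k), fun k => κ (2 * k + 1), fun k hk => hκ _ (by omega),
    fun k hk => hκ _ (by omega), fun z hz0 hg h1 h2 h3 => ?_⟩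
  have h5 := hasStieltjesValue_wOdd_last hm hz0 (hκ (2 * m) (by omega)).isUnit h1 h2 h3
  rw [hκ'] at h5
  generalize wOdd q m _ _ (m - 1) z = w at *
  have hg' : IsUnit (z • gOdd q m A z).det := by
    rw [det_smul]
    exact (IsUnit.mk0 _ (pow_ne_zero _ hz0)).mul (IsUnit.mk0 _ hg)
  have h6 : hOdd q m A z = (z • w⁻¹) * gOdd q m A z := by
    rw [hOdd_eq hz0, gOdd_eq hz0, mul_smul_comm]
    congr 1
    apply h5.1.mul_left_cancel
    rw [← mul_assoc, h5.2, ← map_mul, ← map_mul, h]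
  rw [h6, smul_mul_assoc, ← mul_smul_comm, mul_nonsing_inv_cancel_right _ _ hg']

theorem isHTMOdd_iff_posDef (hm : 1 ≤ m) (hA : A 0 = 1) (hs : ∀ j ≤ 2 * m, (s j).IsHermitian)
    (hM : MarkovOdd q m A s) :
    IsHTMOdd q m (hOdd q m A) (gOdd q m A) ↔
      (H1b q s (m + 1)).PosDef ∧ (H2b q s m).PosDef := by
  rw [← isStieltjesPos_iff_posDef, isStieltjesPos_iff_exists_stieltjesFrac]
  · simp only [hM.X_pow_dvd_iff hA]
    exact ⟨IsHTMOdd.exists_posDef hm hA, fun ⟨κ, hκ, h⟩ => .of_posDef hm hκ h⟩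
  · intro k
    rw [coeff_coe, coeff_altReverse_neg_one_pow_smul]
    split_ifs with hk
    exacts [hs k hk, isHermitian_zero]

end Markov

section Formula

open Polynomial

variable {q m : ℕ} {A s a : ℕ → Mat q}

theorem MarkovOdd.sum_mul_eq (hM : MarkovOdd q m A s) {l : ℕ} (hl : l ≤ m) :
    ∑ k ∈ Finset.range (l + 1), s k * ((-1 : ℂ) ^ (l - k) • A (2 * (l - k))) =
      (-1 : ℂ) ^ l • A (2 * l + 1) := by
  obtain ⟨r, hr⟩ := hM.exists_eq
  have h := congrArg (fun p => coeff p l) hr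
  beta_reduce at h
  rw [coeff_add, coeff_mul, Finset.Nat.sum_antidiagonal_eq_sum_range_succ_mk] at h
  simp only [coeff_altReverse_neg_one_pow_smul] at h
  rw [coeff_X_pow_mul', if_neg (by omega), coeff_altReverse, if_pos hl, add_zero] at h
  rw [← h]
  refine Finset.sum_congr rfl fun k hk => ?_
  rw [Finset.mem_range] at hk
  rw [if_pos (by omega), coeff_altReverse, if_pos (by omega)]

theorem MarkovOdd.sum_mul_eq_zero (hM : MarkovOdd q m A s) {i : ℕ} (hi : i < m) :
    ∑ k ∈ Finset.range (m + 1), s (i + k + 1) * ((-1 : ℂ) ^ (m - k) • A (2 * (m - k))) = 0 := by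
  obtain ⟨r, hr⟩ := hM.exists_eq
  have h := congrArg (fun p => coeff p (m + 1 + i)) hr
  beta_reduce at h
  rw [coeff_add, coeff_mul, Finset.Nat.sum_antidiagonal_eq_sum_range_succ_mk] at h
  simp only [coeff_altReverse_neg_one_pow_smul] at h
  rw [coeff_X_pow_mul', if_neg (by omega), coeff_altReverse, if_neg (by omega), add_zero,
    show (m + 1 + i).succ = (i + 1) + (m + 1) by omega, Finset.sum_range_add,
    Finset.sum_eq_zero, zero_add] at h
  · rw [← h]
    refine Finset.sum_congr rfl fun k hk => ?_
    rw [Finset.mem_range] at hk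
    rw [if_pos (by omega), coeff_altReverse, if_pos (by omega),
      show m + 1 + i - (i + 1 + k) = m - k by omega, show i + 1 + k = i + k + 1 by omega]
  · intro k hk
    rw [Finset.mem_range] at hk
    rw [coeff_altReverse, if_neg (show ¬m + 1 + i - k ≤ m by omega), mul_zero]

theorem conjTranspose_tPol (hs : ∀ j ≤ m, (s j).IsHermitian) (z : ℂ) {i : ℕ} (hi : i ≤ m) :
    (tPol q s i (starRingEnd ℂ z))ᴴ = tPol q s i z := by
  rw [tPol, tPol, conjTranspose_sum]
  refine Finset.sum_congr rfl fun k hk => ?_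
  rw [Finset.mem_range] at hk
  rw [conjTranspose_smul, (hs k (by omega)).eq]
  simp

/-- The block column `(a_m; a_{m-1}; …; a_1)`. -/
def reverseCol (m : ℕ) (a : ℕ → Mat q) : Matrix (Fin m × Fin q) (Fin q) ℂ :=
  of fun p b => a (m - p.1) p.2 b

theorem conjTranspose_Y2b_mul_inv (hH : (H2b q s m).PosDef) (ha : a 0 = 1)
    (h : ∀ i < m, ∑ k ∈ Finset.range (m + 1), s (i + k + 1) * a (m - k) = 0) :
    (Y2b q s m)ᴴ * (H2b q s m)⁻¹ = -(reverseCol m a)ᴴ := by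
  have hY : Y2b q s m = -(H2b q s m * reverseCol m a) := by
    rw [← add_eq_zero_iff_eq_neg]
    ext ⟨i, x⟩ b
    have := congrFun (congrFun (h i i.2) x) b
    rw [Finset.sum_range_succ, Nat.sub_self, ha, mul_one, Finset.sum_range, Matrix.add_apply, Matrix.sum_apply,
      add_comm] at this
    simp only [Matrix.mul_apply] at this
    rw [Matrix.add_apply, Matrix.mul_apply, Fintype.sum_prod_type]
    refine Eq.trans ?_ this
    simp [Y2b, H2b, reverseCol, add_right_comm, add_comm (i : ℕ) m]
  rw [hY, conjTranspose_neg, conjTranspose_mul, hH.isHermitian.eq, Matrix.neg_mul,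
    mul_nonsing_inv_cancel_right _ _ ((isUnit_iff_isUnit_det _).1 hH.isUnit)]

theorem conjTranspose_mul_reverseCol (B : ℕ → Mat q) :
    (of fun (p : Fin m × Fin q) b => B p.1 p.2 b : Matrix (Fin m × Fin q) (Fin q) ℂ)ᴴ *
      reverseCol m a = ∑ k ∈ Finset.range m, (B k)ᴴ * a (m - k) := by
  ext x y
  rw [Matrix.mul_apply, Fintype.sum_prod_type, Finset.sum_range, Matrix.sum_apply]
  simp [Matrix.mul_apply, reverseCol]

theorem conjTranspose_P2 (hH : (H2b q s m).PosDef) (ha : a 0 = 1)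
    (h : ∀ i < m, ∑ k ∈ Finset.range (m + 1), s (i + k + 1) * a (m - k) = 0) (u : ℂ) :
    (P2 q s m (starRingEnd ℂ u))ᴴ = ∑ j ∈ Finset.range (m + 1), u ^ (m - j) • a j := by
  have hc : colPow q m (starRingEnd ℂ u) =
      of fun p b => (starRingEnd ℂ u ^ (p.1 : ℕ) • (1 : Mat q)) p.2 b := by
    ext p b
    simp [colPow, Matrix.one_apply]
  have hr : ∑ j ∈ Finset.range (m + 1), u ^ (m - j) • a j =
      ∑ j ∈ Finset.range (m + 1), u ^ j • a (m - j) := by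
    rw [← Finset.sum_range_reflect]
    refine Finset.sum_congr rfl fun j hj => ?_
    rw [Finset.mem_range] at hj
    rw [add_tsub_cancel_right, Nat.sub_sub_self (by omega)]
  rw [P2, conjTranspose_Y2b_mul_inv hH ha h, Matrix.neg_mul, sub_neg_eq_add, conjTranspose_add,
    conjTranspose_mul, conjTranspose_conjTranspose, hc,
    conjTranspose_mul_reverseCol fun k => starRingEnd ℂ u ^ k • (1 : Mat q),
    hr, Finset.sum_range_succ, add_comm]
  simp [ha]

theorem conjTranspose_Q2 (hs : ∀ j ≤ m, (s j).IsHermitian) (hH : (H2b q s m).PosDef)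
    (ha : a 0 = 1)
    (h : ∀ i < m, ∑ k ∈ Finset.range (m + 1), s (i + k + 1) * a (m - k) = 0) (u : ℂ) :
    (Q2 q s m (starRingEnd ℂ u))ᴴ =
      ∑ l ∈ Finset.range (m + 1), u ^ (m - l) • ∑ k ∈ Finset.range (l + 1), s k * a (l - k) := by
  have h1 : (Q2 q s m (starRingEnd ℂ u))ᴴ =
      ∑ k ∈ Finset.range (m + 1), tPol q s k u * a (m - k) := by
    rw [Q2, conjTranspose_Y2b_mul_inv hH ha h, Matrix.neg_mul, sub_neg_eq_add, conjTranspose_add,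
      conjTranspose_mul, conjTranspose_conjTranspose, colT,
      conjTranspose_mul_reverseCol fun k => tPol q s k (starRingEnd ℂ u),
      conjTranspose_tPol hs _ le_rfl, Finset.sum_range_succ, Nat.sub_self, ha, mul_one, add_comm]
    congr 1
    refine Finset.sum_congr rfl fun k hk => ?_
    rw [Finset.mem_range] at hk
    rw [conjTranspose_tPol hs _ hk.le]
  rw [h1]
  simp only [tPol, Finset.sum_mul, Finset.smul_sum, Finset.sum_sigma', smul_mul_assoc]
  refine Finset.sum_bij' (fun p _ => ⟨m - p.1 + p.2, p.2⟩) (fun p _ => ⟨m - p.1 + p.2, p.2⟩)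
    ?_ ?_ ?_ ?_ ?_
  all_goals
    rintro ⟨k, l⟩ hkl
    simp only [Finset.mem_sigma, Finset.mem_range] at hkl ⊢
  · omega
  · omega
  · simp only [Sigma.mk.injEq, heq_eq_eq, and_true]
    omega
  · simp only [Sigma.mk.injEq, heq_eq_eq, and_true]
    omega
  · rw [show m - (m - k + l) = k - l by omega, show m - k + l - l = m - k by omega]

theorem fPoly_two_mul_add_one (z : ℂ) :
    fPoly q (2 * m + 1) A z = hOdd q m A (z ^ 2) + z • gOdd q m A (z ^ 2) := by
  have key (F : ℕ → Mat q) (n : ℕ) : ∑ j ∈ Finset.range (2 * n), F j =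
      ∑ j ∈ Finset.range n, F (2 * j + 1) + ∑ j ∈ Finset.range n, F (2 * j) := by
    induction n with
    | zero => simp
    | succ n ih =>
      rw [show 2 * (n + 1) = 2 * n + 1 + 1 by ring]
      simp only [Finset.sum_range_succ, ih]
      abel
  rw [fPoly, show 2 * m + 1 + 1 = 2 * (m + 1) by ring, key, hOdd, gOdd, Finset.smul_sum]
  congr 1 <;> refine Finset.sum_congr rfl fun j hj => ?_ <;> rw [Finset.mem_range] at hj
  · rw [← pow_mul]
    congr 2
    omega
  · rw [smul_smul, ← pow_mul, ← pow_succ']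
    congr 2
    omega

theorem fPoly_eq_of_posDef (hA : A 0 = 1) (hs : ∀ j ≤ m, (s j).IsHermitian)
    (hM : MarkovOdd q m A s) (hH : (H2b q s m).PosDef) (z : ℂ) :
    fPoly q (2 * m + 1) A z =
      (-1 : ℂ) ^ m •
        ((Q2 q s m ((starRingEnd ℂ) (-z ^ 2)))ᴴ
          + z • (P2 q s m ((starRingEnd ℂ) (-z ^ 2)))ᴴ) := by
  have hpow {j : ℕ} (hj : j ∈ Finset.range (m + 1)) :
      (-1 : ℂ) ^ m * ((-z ^ 2) ^ (m - j) * (-1) ^ j) = (z ^ 2) ^ (m - j) := by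
    rw [neg_pow (z ^ 2), mul_right_comm, ← pow_add, ← mul_assoc, ← pow_add,
      Nat.sub_add_cancel (Nat.lt_succ_iff.mp (Finset.mem_range.mp hj)), ← two_mul, pow_mul]
    simp
  have ha : (-1 : ℂ) ^ 0 • A (2 * 0) = 1 := by simp [hA]
  have h i (hi : i < m) := hM.sum_mul_eq_zero hi
  rw [conjTranspose_P2 (a := fun j => (-1 : ℂ) ^ j • A (2 * j)) hH ha h,
    conjTranspose_Q2 (a := fun j => (-1 : ℂ) ^ j • A (2 * j)) hs hH ha h, smul_add,
    smul_comm _ z, fPoly_two_mul_add_one, hOdd, gOdd]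
  congr 1
  · rw [Finset.smul_sum]
    refine Finset.sum_congr rfl fun j hj => ?_
    rw [hM.sum_mul_eq (Nat.lt_succ_iff.mp (Finset.mem_range.mp hj)), smul_smul, smul_smul,
      mul_assoc, hpow hj]
  · rw [Finset.smul_sum (r := (-1 : ℂ) ^ m)]
    congr 1
    refine Finset.sum_congr rfl fun j hj => ?_
    rw [smul_smul, smul_smul, mul_assoc, hpow hj]

end Formula

theorem stmt_7 (q m : ℕ) (hq : 1 ≤ q) (hm : 1 ≤ m) (A s : ℕ → Mat q)
    (hmonic : A 0 = 1) (hherm : ∀ j ≤ 2 * m, (s j).IsHermitian)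
    (hM : MarkovOdd q m A s) :
    IsHTMOdd q m (hOdd q m A) (gOdd q m A) ↔
      ((H1b q s (m + 1)).PosDef ∧ (H2b q s m).PosDef ∧
        ∀ z : ℂ, fPoly q (2 * m + 1) A z =
          (-1 : ℂ) ^ m •
            ((Q2 q s m ((starRingEnd ℂ) (-z ^ 2)))ᴴ
              + z • (P2 q s m ((starRingEnd ℂ) (-z ^ 2)))ᴴ)) := by
  rw [isHTMOdd_iff_posDef hm hmonic hherm hM]
  exact ⟨fun h => ⟨h.1, h.2, fPoly_eq_of_posDef hmonic (fun j hj => hherm j (by omega)) hM h.2⟩,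
    fun h => ⟨h.1, h.2.1⟩⟩

end
end

section
/- Let f be a Hurwitz-type matrix (HTM) polynomial of degree 2m+1. Then its h-part h and the polynomial z·g(z) (g the g-part) are right coprime; equivalently (Bézout identity), there exist q×q matrix polynomials X and Y such that X(z)·h(z) + Y(z)·z·g(z) = I_q for all z ∈ ℂ. -/
open Matrix MeasureTheory
open scoped ComplexOrder

noncomputable section

/-- Evaluation of a polynomial with matrix coefficients at a complex scalar. -/
def evalScalar (q : ℕ) (z : ℂ) : Polynomial (Mat q) →+* Mat q :=
  Polynomial.eval₂RingHom' (RingHom.id _) (scalar (Fin q) z)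
    fun a => (scalar_commute z (fun r => Commute.all z r) a).symm

lemma evalScalar_C (q : ℕ) (z : ℂ) (a : Mat q) : evalScalar q z (Polynomial.C a) = a := by
  simp [evalScalar]

lemma evalScalar_X_mul (q : ℕ) (z : ℂ) (p : Polynomial (Mat q)) :
    evalScalar q z (Polynomial.X * p) = z • evalScalar q z p := by
  rw [map_mul]
  have : evalScalar q z Polynomial.X = scalar (Fin q) z := by simp [evalScalar]
  rw [this, scalar_apply, ← smul_eq_diagonal_mul]

lemma evalScalar_monomial (q : ℕ) (z : ℂ) (n : ℕ) (a : Mat q) :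
    evalScalar q z (Polynomial.monomial n a) = z ^ n • a := by
  induction n with
  | zero => simp [evalScalar_C]
  | succ n ih =>
    rw [← Polynomial.X_mul_monomial, evalScalar_X_mul, ih, smul_smul, pow_succ']

lemma evalScalar_eq_sum_range (q : ℕ) (z : ℂ) (p : Polynomial (Mat q)) {N : ℕ}
    (hN : p.natDegree ≤ N) :
    evalScalar q z p = ∑ i ∈ Finset.range (N + 1), z ^ i • p.coeff i := by
  conv_lhs => rw [p.as_sum_range' (N + 1) (by omega)]
  simp only [map_sum, evalScalar_monomial]

lemma eq_of_infinite_evalScalar_eq {q : ℕ} (p r : Polynomial (Mat q))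
    (h : Set.Infinite {z : ℂ | evalScalar q z p = evalScalar q z r}) : p = r := by
  have key : ∀ (p : Polynomial (Mat q)) (z : ℂ) (i j : Fin q),
      (matPolyEquiv.symm p i j).eval z = evalScalar q z p i j := by
    intro p z i j
    rw [← matPolyEquiv_eval, AlgEquiv.apply_symm_apply]
    rfl
  apply matPolyEquiv.symm.injective
  ext1 i j
  refine Polynomial.eq_of_infinite_eval_eq _ _ (h.mono fun z hz => ?_)
  rw [Set.mem_ofPred_eq] at hz ⊢
  rw [key, key, hz]

/-- Right coprime matrix polynomials `P` and `Q` with `deg P = n + 1`, `deg Q ≤ n` and invertible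
leading coefficient of `P`, such that `P = w Q` on the positive half-line, where `w` takes
Hermitian positive definite values. -/
structure IsPositiveFraction (q n : ℕ) (w : ℂ → Mat q) (P Q : Polynomial (Mat q)) : Prop where
  natDegree_num : P.natDegree ≤ n + 1
  isUnit_coeff : IsUnit (P.coeff (n + 1))
  natDegree_den : Q.natDegree ≤ n
  bezout : ∃ X Y : Polynomial (Mat q), X * P + Y * Q = 1
  posDef : ∀ z : ℂ, 0 < z → (w z).PosDef
  eval_num : ∀ z : ℂ, 0 < z → evalScalar q z P = w z * evalScalar q z Q

lemma isPositiveFraction_smul {q : ℕ} {c : Mat q} (hc : c.PosDef) :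
    IsPositiveFraction q 0 (fun z => z • c) (Polynomial.X * Polynomial.C c) 1 where
  natDegree_num := by
    have h1 := Polynomial.natDegree_mul_le (p := Polynomial.X) (q := Polynomial.C c)
    have h2 := Polynomial.natDegree_X_le (R := Mat q)
    rw [Polynomial.natDegree_C] at h1
    omega
  isUnit_coeff := by simpa using hc.isUnit
  natDegree_den := by simp
  bezout := ⟨0, 1, by simp⟩
  posDef _ hz := hc.smul hz
  eval_num z _ := by rw [evalScalar_X_mul, evalScalar_C, map_one, mul_one]

lemma exists_bezout_step {R : Type*} [Ring R] {x y p s : R} (h : x * p + y * s = 1) (t c d : R) :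
    ∃ x' y' : R, x' * (t * (c * (d * p + s)) + p) + y' * (d * p + s) = 1 :=
  ⟨x - y * d, y - (x - y * d) * t * c, by rw [← h]; noncomm_ring⟩

lemma IsPositiveFraction.step {q n : ℕ} {w : ℂ → Mat q} {P Q : Polynomial (Mat q)}
    (h : IsPositiveFraction q n w P Q) {c d : Mat q} (hc : c.PosDef) (hd : d.PosDef) :
    IsPositiveFraction q (n + 1) (fun z => z • c + (d + (w z)⁻¹)⁻¹)
      (Polynomial.X * (Polynomial.C c * (Polynomial.C d * P + Q)) + P)
      (Polynomial.C d * P + Q) := by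
  have hden : (Polynomial.C d * P + Q).natDegree ≤ n + 1 :=
    Polynomial.natDegree_add_le_of_degree_le
      ((Polynomial.natDegree_C_mul_le _ _).trans h.natDegree_num)
      (h.natDegree_den.trans (Nat.le_succ n))
  refine ⟨?_, ?_, hden, ?_, ?_, ?_⟩
  · refine Polynomial.natDegree_add_le_of_degree_le ?_ (h.natDegree_num.trans (Nat.le_succ _))
    refine Polynomial.natDegree_mul_le.trans ?_
    have := Polynomial.natDegree_X_le (R := Mat q)
    have := (Polynomial.natDegree_C_mul_le c (Polynomial.C d * P + Q)).trans hden
    omega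
  · have hP : P.coeff (n + 1 + 1) = 0 :=
      Polynomial.coeff_eq_zero_of_natDegree_lt (by have := h.natDegree_num; omega)
    have hQ : Q.coeff (n + 1) = 0 :=
      Polynomial.coeff_eq_zero_of_natDegree_lt (by have := h.natDegree_den; omega)
    rw [Polynomial.coeff_add, Polynomial.coeff_X_mul, Polynomial.coeff_C_mul,
      Polynomial.coeff_add, Polynomial.coeff_C_mul, hP, hQ, add_zero, add_zero]
    exact hc.isUnit.mul (hd.isUnit.mul h.isUnit_coeff)
  · obtain ⟨X, Y, hXY⟩ := h.bezout
    exact exists_bezout_step hXY Polynomial.X (Polynomial.C c) (Polynomial.C d)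
  · intro z hz
    exact (hc.smul hz).add (hd.add (h.posDef z hz).inv).inv
  · intro z hz
    have hw := (Matrix.isUnit_iff_isUnit_det _).1 (h.posDef z hz).isUnit
    have hs := (Matrix.isUnit_iff_isUnit_det _).1 (hd.add (h.posDef z hz).inv).isUnit
    have hQ : evalScalar q z Q = (w z)⁻¹ * evalScalar q z P := by
      rw [h.eval_num z hz, Matrix.nonsing_inv_mul_cancel_left _ _ hw]
    rw [map_add, evalScalar_X_mul, map_mul, evalScalar_C, map_add, map_mul, evalScalar_C, hQ,
      ← add_mul, add_mul (z • c), Matrix.nonsing_inv_mul_cancel_left _ _ hs, smul_mul_assoc]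

lemma exists_isPositiveFraction_wOdd {q m : ℕ} {c d : ℕ → Mat q}
    (hc : ∀ k ≤ m, (c k).PosDef) (hd : ∀ k < m, (d k).PosDef) {j : ℕ} (hj : j < m) :
    ∃ P Q, IsPositiveFraction q (j + 1) (wOdd q m c d j) P Q := by
  induction j with
  | zero =>
    have h := (isPositiveFraction_smul (hc m le_rfl)).step
      (hc (m - 1) (by omega)) (hd (m - 1) (by omega))
    refine ⟨_, _, h.natDegree_num, h.isUnit_coeff, h.natDegree_den, h.bezout, ?_, ?_⟩
    all_goals
      intro z hz
      have hinv : (z • c m)⁻¹ = z⁻¹ • (c m)⁻¹ := Matrix.inv_smul' _ (Units.mk0 z hz.ne')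
        ((Matrix.isUnit_iff_isUnit_det _).1 (hc m le_rfl).isUnit)
      have h1 := h.posDef z hz
      have h2 := h.eval_num z hz
      simp only [hinv] at h1 h2
      first | exact h1 | exact h2
  | succ j ih =>
    obtain ⟨P, Q, h⟩ := ih (by omega)
    exact ⟨_, _, h.step (hc (m - 2 - j) (by omega)) (hd (m - 2 - j) (by omega))⟩

lemma infinite_setOf_det_gOdd_ne_zero {q m : ℕ} {A : ℕ → Mat q} (hA0 : (A 0).det ≠ 0) :
    {z : ℂ | 0 < z ∧ (gOdd q m A z).det ≠ 0}.Infinite := by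
  have hcont : Continuous fun t : ℝ =>
      (∑ j ∈ Finset.range (m + 1), (t : ℂ) ^ j • A (2 * j)).det := by
    apply Continuous.matrix_det
    fun_prop
  have h0 : (∑ j ∈ Finset.range (m + 1), ((0 : ℝ) : ℂ) ^ j • A (2 * j)).det ≠ 0 := by
    rw [Finset.sum_range_succ']
    simpa using hA0
  obtain ⟨ε, hε, hball⟩ := Metric.eventually_nhds_iff.1 (hcont.continuousAt.eventually_ne h0)
  have hinj : Function.Injective fun t : ℝ => ((t⁻¹ : ℝ) : ℂ) :=
    Complex.ofReal_injective.comp inv_injective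
  refine ((Set.Ioo_infinite hε).image hinj.injOn).mono ?_
  rintro _ ⟨t, ⟨ht0, htε⟩, rfl⟩
  have ht : (t : ℂ) ≠ 0 := by exact_mod_cast ht0.ne'
  refine ⟨Complex.zero_lt_real.2 (inv_pos.2 ht0), ?_⟩
  have hrev : gOdd q m A ((t⁻¹ : ℝ) : ℂ) =
      ((t : ℂ)⁻¹ ^ m) • ∑ j ∈ Finset.range (m + 1), (t : ℂ) ^ j • A (2 * j) := by
    rw [gOdd, Finset.smul_sum]
    refine Finset.sum_congr rfl fun j hj => ?_
    have hjm : j ≤ m := Nat.lt_succ_iff.1 (Finset.mem_range.1 hj)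
    rw [smul_smul, Complex.ofReal_inv]
    congr 1
    rw [← Nat.sub_add_cancel hjm, pow_add, Nat.add_sub_cancel, mul_assoc, ← mul_pow,
      inv_mul_cancel₀ ht, one_pow, mul_one]
  rw [hrev, det_smul]
  refine mul_ne_zero (pow_ne_zero _ (pow_ne_zero _ (inv_ne_zero ht))) (hball ?_)
  rwa [Real.dist_eq, sub_zero, abs_of_pos ht0]

lemma mul_bezout_eq {R : Type*} [Ring R] [IsDedekindFiniteMonoid R] {x y p s w v g h : R}
    (hxy : x * p + y * s = 1) (hv : v * w = 1) (hp : p = w * s) (hh : h = v * g) :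
    p * (x * g + y * h) = g := by
  have h1 : (x + y * v) * p = 1 := by
    rw [add_mul, mul_assoc y, hp, ← mul_assoc v, hv, one_mul, ← hp, hxy]
  have h2 := mul_eq_one_comm.1 h1
  rw [hh, ← mul_assoc y, ← add_mul, ← mul_assoc, h2, one_mul]

lemma exists_isUnit_eq_C_of_mul_eq {R : Type*} [Ring R] [Nontrivial R] {P U G : Polynomial R}
    {n : ℕ} (hP : P.natDegree ≤ n) (hPn : IsUnit (P.coeff n)) (hG : G.natDegree ≤ n)
    (hGn : IsUnit (G.coeff n)) (h : P * U = G) : ∃ u, IsUnit u ∧ U = Polynomial.C u := by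
  have hPdeg : P.natDegree = n := le_antisymm hP (Polynomial.le_natDegree_of_ne_zero hPn.ne_zero)
  have hU : U ≠ 0 := by
    rintro rfl
    rw [← h, mul_zero, Polynomial.coeff_zero] at hGn
    exact not_isUnit_zero hGn
  have hlead : P.leadingCoeff * U.leadingCoeff ≠ 0 := by
    rw [Polynomial.leadingCoeff, hPdeg, Ne, hPn.mul_right_eq_zero]
    exact Polynomial.leadingCoeff_ne_zero.2 hU
  have hdeg := Polynomial.natDegree_mul' hlead
  rw [h, hPdeg] at hdeg
  have hUC := Polynomial.eq_C_of_natDegree_eq_zero (p := U) (by omega)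
  refine ⟨_, ?_, hUC⟩
  rw [← h, hUC, Polynomial.coeff_mul_C] at hGn
  exact (hPn.mul_left_iff).1 hGn

theorem stmt_9 (q m : ℕ) (hq : 1 ≤ q) (hm : 1 ≤ m) (A : ℕ → Mat q)
    (hA0 : (A 0).det ≠ 0)
    (hHTM : IsHTMOdd q m (hOdd q m A) (gOdd q m A)) :
    ∃ (N : ℕ) (X Y : ℕ → Mat q), ∀ z : ℂ,
      (∑ i ∈ Finset.range (N + 1), z ^ i • X i) * hOdd q m A z
        + (∑ i ∈ Finset.range (N + 1), z ^ i • Y i) * (z • gOdd q m A z) = 1 := by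
  have : NeZero q := ⟨by omega⟩
  obtain ⟨c, d, hc, hd, hfrac⟩ := hHTM
  have hpos : ∀ j < m, ∀ z : ℂ, 0 < z → (wOdd q m c d j z).PosDef := fun j hj =>
    let ⟨_, _, h⟩ := exists_isPositiveFraction_wOdd hc hd hj
    h.posDef
  have hunit : ∀ {M : Mat q}, M.PosDef → IsUnit M.det := fun hM =>
    (Matrix.isUnit_iff_isUnit_det _).1 hM.isUnit
  obtain ⟨P, Q, hPQ⟩ := exists_isPositiveFraction_wOdd hc hd (j := m - 1) (by omega)
  rw [Nat.sub_add_cancel hm] at hPQ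
  obtain ⟨X, Y, hXY⟩ := hPQ.bezout
  let H : Polynomial (Mat q) :=
    ∑ j ∈ Finset.range (m + 1), Polynomial.monomial (m - j) (A (2 * j + 1))
  let G : Polynomial (Mat q) :=
    ∑ j ∈ Finset.range (m + 1), Polynomial.monomial (m - j) (A (2 * j))
  have hH : ∀ z, evalScalar q z H = hOdd q m A z := fun z => by
    simp only [H, hOdd, map_sum, evalScalar_monomial]
  have hG : ∀ z, evalScalar q z (Polynomial.X * G) = z • gOdd q m A z := fun z => by
    simp only [G, gOdd, evalScalar_X_mul, map_sum, evalScalar_monomial]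
  have hGdeg : (Polynomial.X * G).natDegree ≤ m + 1 := by
    have h1 : G.natDegree ≤ m := Polynomial.natDegree_sum_le_of_forall_le _ _ fun j _ =>
      (Polynomial.natDegree_monomial_le _).trans (Nat.sub_le m j)
    have h2 := Polynomial.natDegree_mul_le (p := Polynomial.X) (q := G)
    have h3 := Polynomial.natDegree_X_le (R := Mat q)
    omega
  have hGcoeff : IsUnit ((Polynomial.X * G).coeff (m + 1)) := by
    have hG0 : G.coeff m = A 0 := by
      simp only [G, Polynomial.finsetSum_coeff, Polynomial.coeff_monomial]
      rw [Finset.sum_eq_single 0]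
      · simp
      · intro j hj hj0
        exact if_neg (by omega)
      · simp
    rw [Polynomial.coeff_X_mul, hG0, Matrix.isUnit_iff_isUnit_det]
    exact hA0.isUnit
  have hmul : P * (X * (Polynomial.X * G) + Y * H) = Polynomial.X * G := by
    refine eq_of_infinite_evalScalar_eq _ _
      ((infinite_setOf_det_gOdd_ne_zero (m := m) hA0).mono ?_)
    rintro z ⟨hz, hdet⟩
    have hinv : 0 < z⁻¹ := inv_pos.2 hz
    have hw := hfrac z hz.ne' hdet
      (hunit ((hd _ (by omega)).add ((hc m le_rfl).inv.smul hinv)))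
      (fun j hj => hunit (hpos j hj z hz))
      (fun j hj => hunit ((hd _ (by omega)).add (hpos j (by omega) z hz).inv))
    have hgdet : IsUnit (z • gOdd q m A z).det := by
      rw [det_smul]
      exact (mul_ne_zero (pow_ne_zero _ hz.ne') hdet).isUnit
    have hh : hOdd q m A z = (wOdd q m c d (m - 1) z)⁻¹ * (z • gOdd q m A z) := by
      rw [← hw, Matrix.nonsing_inv_mul_cancel_right _ _ hgdet]
    have hb := congrArg (evalScalar q z) hXY
    rw [map_add, map_mul, map_mul, map_one] at hb
    rw [Set.mem_ofPred_eq, map_mul _ P, map_add, map_mul _ X, map_mul _ Y, hG, hH]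
    exact mul_bezout_eq hb (Matrix.nonsing_inv_mul _ (hunit (hPQ.posDef z hz)))
      (hPQ.eval_num z hz) hh
  obtain ⟨u, ⟨v, rfl⟩, hU⟩ := exists_isUnit_eq_C_of_mul_eq hPQ.natDegree_num hPQ.isUnit_coeff
    hGdeg hGcoeff hmul
  let X' := Polynomial.C (↑v⁻¹ : Mat q) * Y
  let Y' := Polynomial.C (↑v⁻¹ : Mat q) * X
  have hbez : X' * H + Y' * (Polynomial.X * G) = 1 := by
    simp only [X', Y']
    rw [mul_assoc, mul_assoc, ← mul_add, add_comm, hU, ← Polynomial.C_mul, Units.inv_mul,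
      Polynomial.C_1]
  refine ⟨max X'.natDegree Y'.natDegree, X'.coeff, Y'.coeff, fun z => ?_⟩
  rw [← evalScalar_eq_sum_range q z X' (le_max_left _ _),
    ← evalScalar_eq_sum_range q z Y' (le_max_right _ _), ← hH, ← hG, ← map_mul, ← map_mul,
    ← map_add, hbez, map_one]

end
end

section
/- Let f(z) = A_0 z^n + A_1 z^{n-1} + ... + A_n be a q×q matrix polynomial (n = 2m or n = 2m+1, m ≥ 1) whose coefficients satisfy Condition C, with h-part h and g-part g. Then there exist q×q matrix polynomials T_1, T_2, T_3 in two variables such that for all x, y ∈ ℂ: (i) x²·g^♯(x²)·h(y²) − y²·h^♯(x²)·g(y²) = (x²−y²)·T_1(x,y); (ii) x·y·( g^♯(x²)·h(y²) − h^♯(x²)·g(y²) ) = (x²−y²)·T_2(x,y); (iii) f^♯(x)·f(−y) − f^♯(−x)·f(y) = (x−y)·T_3(x,y). (That is, the Bezoutian forms 𝓖^{(1)}, 𝓖^{(2)} and 𝓕 associated with f are polynomials in x and y.) -/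
open Matrix MeasureTheory
open scoped ComplexOrder

noncomputable section

/-- The matrix polynomials in two variables, as a space of functions. -/
def bivariatePoly (q : ℕ) : Submodule ℂ (ℂ → ℂ → Mat q) :=
  Submodule.span ℂ
    (Set.range fun p : (ℕ × ℕ) × Mat q => fun x y : ℂ => (x ^ p.1.1 * y ^ p.1.2) • p.2)

theorem monomial_mem_bivariatePoly {q : ℕ} (a b : ℕ) (B : Mat q) :
    (fun x y : ℂ => (x ^ a * y ^ b) • B) ∈ bivariatePoly q :=
  Submodule.subset_span ⟨((a, b), B), rfl⟩

theorem exists_coeff_of_mem_bivariatePoly {q : ℕ} {F : ℂ → ℂ → Mat q}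
    (hF : F ∈ bivariatePoly q) :
    ∃ N₀ : ℕ, ∀ N ≥ N₀, ∃ T : ℕ → ℕ → Mat q, ∀ x y : ℂ,
      F x y = ∑ j ∈ Finset.range N, ∑ k ∈ Finset.range N, (x ^ j * y ^ k) • T j k := by
  induction hF using Submodule.span_induction with
  | mem F hF =>
    obtain ⟨⟨⟨a, b⟩, B⟩, rfl⟩ := hF
    refine ⟨max a b + 1, fun N hN => ⟨fun j k => if j = a then if k = b then B else 0 else 0,
      fun x y => ?_⟩⟩
    rw [Finset.sum_eq_single_of_mem a (by simp; omega) (by simp +contextual),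
      Finset.sum_eq_single_of_mem b (by simp; omega) (by simp +contextual)]
    simp
  | zero => exact ⟨0, fun N _ => ⟨0, by simp⟩⟩
  | add F G _ _ hF hG =>
    obtain ⟨N₁, h₁⟩ := hF
    obtain ⟨N₂, h₂⟩ := hG
    refine ⟨max N₁ N₂, fun N hN => ?_⟩
    obtain ⟨T₁, hT₁⟩ := h₁ N (le_trans (le_max_left _ _) hN)
    obtain ⟨T₂, hT₂⟩ := h₂ N (le_trans (le_max_right _ _) hN)
    exact ⟨T₁ + T₂, fun x y => by simp [hT₁, hT₂, Finset.sum_add_distrib]⟩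
  | smul c F _ hF =>
    obtain ⟨N₀, h₀⟩ := hF
    refine ⟨N₀, fun N hN => ?_⟩
    obtain ⟨T, hT⟩ := h₀ N hN
    exact ⟨c • T, fun x y => by simp [hT, Finset.smul_sum, smul_comm c]⟩

/-- The matrix polynomials in two variables that are divisible by `x ^ s - y ^ s`. -/
def powSubPowMultiples (q s : ℕ) : Submodule ℂ (ℂ → ℂ → Mat q) where
  carrier := {F | ∃ G ∈ bivariatePoly q, ∀ x y : ℂ, F x y = (x ^ s - y ^ s) • G x y}
  zero_mem' := ⟨0, zero_mem _, by simp⟩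
  add_mem' := by
    rintro _ _ ⟨G₁, h₁, e₁⟩ ⟨G₂, h₂, e₂⟩
    exact ⟨G₁ + G₂, add_mem h₁ h₂, by simp [e₁, e₂]⟩
  smul_mem' := by
    rintro c _ ⟨G, hG, e⟩
    exact ⟨c • G, Submodule.smul_mem _ c hG, fun x y => by simp [e, smul_comm c]⟩

theorem antisymm_mem_powSubPowMultiples {q : ℕ} (s c a b : ℕ) (B : Mat q) :
    (fun x y : ℂ => (x ^ c * y ^ c * ((x ^ s) ^ a * (y ^ s) ^ b - (x ^ s) ^ b * (y ^ s) ^ a)) • B)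
      ∈ powSubPowMultiples q s := by
  wlog hab : b ≤ a generalizing a b
  · convert neg_mem (this b a (by omega)) using 1
    funext x y
    rw [Pi.neg_apply, Pi.neg_apply, ← neg_smul]
    ring_nf
  obtain ⟨d, rfl⟩ := Nat.exists_eq_add_of_le hab
  refine ⟨∑ i ∈ Finset.range d,
    fun x y => (x ^ (c + s * b + s * i) * y ^ (c + s * b + s * (d - 1 - i))) • B,
    sum_mem fun i _ => monomial_mem_bivariatePoly _ _ _, fun x y => ?_⟩
  have hd := (Commute.all (x ^ s) (y ^ s)).geom_sum₂_mul d
  simp only [Finset.sum_apply]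
  rw [← Finset.sum_smul, smul_smul]
  congr 1
  calc _ = x ^ c * y ^ c * (x ^ s) ^ b * (y ^ s) ^ b * ((x ^ s) ^ d - (y ^ s) ^ d) := by ring
    _ = _ := by
      rw [← hd, ← mul_assoc, mul_comm, Finset.mul_sum]
      congr 1
      refine Finset.sum_congr rfl fun i _ => ?_
      simp only [pow_add, pow_mul]
      ring

theorem conjTranspose_sum_smul_mul_sum_smul {q : ℕ} (I K : Finset ℕ) (u v : ℕ → ℂ)
    (P Q : ℕ → Mat q) :
    (∑ i ∈ I, (starRingEnd ℂ) (u i) • P i)ᴴ * ∑ k ∈ K, v k • Q k =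
      ∑ i ∈ I, ∑ k ∈ K, (u i * v k) • ((P i)ᴴ * Q k) := by
  rw [Matrix.conjTranspose_sum, Finset.sum_mul_sum]
  refine Finset.sum_congr rfl fun i _ => Finset.sum_congr rfl fun k _ => ?_
  rw [Matrix.conjTranspose_smul, smul_mul_smul_comm]
  simp

theorem bezout_mem_powSubPowMultiples {q : ℕ} (s c d I K : ℕ) (a b : ℕ → ℕ) (G H : ℕ → Mat q)
    (hGH : ∀ i < I, ∀ k < K, (G i)ᴴ * H k = (H k)ᴴ * G i) :
    (fun x y : ℂ => (x ^ c * y ^ c) • ((x ^ s) ^ d •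
        ((∑ i ∈ Finset.range I, (starRingEnd ℂ) (x ^ s) ^ a i • G i)ᴴ *
          ∑ k ∈ Finset.range K, (y ^ s) ^ b k • H k) -
      (y ^ s) ^ d • ((∑ k ∈ Finset.range K, (starRingEnd ℂ) (x ^ s) ^ b k • H k)ᴴ *
          ∑ i ∈ Finset.range I, (y ^ s) ^ a i • G i))) ∈ powSubPowMultiples q s := by
  have hmem := sum_mem (t := Finset.range I) fun i _ =>
    sum_mem (t := Finset.range K) fun k _ =>
      antisymm_mem_powSubPowMultiples s c (a i + d) (b k) ((G i)ᴴ * H k)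
  convert hmem using 1
  funext x y
  simp only [Finset.sum_apply, ← map_pow (starRingEnd ℂ) (x ^ s),
    conjTranspose_sum_smul_mul_sum_smul]
  rw [Finset.sum_comm (s := Finset.range K)]
  simp only [Finset.smul_sum, ← Finset.sum_sub_distrib]
  refine Finset.sum_congr rfl fun i hi => Finset.sum_congr rfl fun k hk => ?_
  rw [← hGH i (Finset.mem_range.1 hi) k (Finset.mem_range.1 hk)]
  simp only [smul_smul, ← sub_smul]
  congr 1
  ring

theorem fPoly_bezout_mem_powSubPowMultiples {q n : ℕ} {A : ℕ → Mat q} (hC : CondC q n A) :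
    (fun x y : ℂ => (fPoly q n A ((starRingEnd ℂ) x))ᴴ * fPoly q n A (-y)
      - (fPoly q n A ((starRingEnd ℂ) (-x)))ᴴ * fPoly q n A y) ∈ powSubPowMultiples q 1 := by
  let ε : ℕ → ℂ := fun i => (-1) ^ (n - i)
  have hmem := Submodule.smul_mem _ (1 / 2 : ℂ) <|
    sum_mem (t := Finset.range (n + 1)) fun i _ => sum_mem (t := Finset.range (n + 1)) fun k _ =>
      Submodule.smul_mem _ (ε k - ε i)
        (antisymm_mem_powSubPowMultiples 1 0 (n - i) (n - k) ((A i)ᴴ * A k))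
  convert hmem using 1
  funext x y
  let t : ℕ → ℕ → Mat q := fun i k =>
    ((ε k - ε i) * (x ^ (n - i) * y ^ (n - k))) • ((A i)ᴴ * A k)
  have hsymm : ∀ i ∈ Finset.range (n + 1), ∀ k ∈ Finset.range (n + 1),
      (ε k - ε i) • ((A i)ᴴ * A k) = (ε k - ε i) • ((A k)ᴴ * A i) := by
    intro i hi k hk
    simp only [Finset.mem_range] at hi hk
    rcases Nat.mod_two_eq_zero_or_one i with hi' | hi' <;>
      rcases Nat.mod_two_eq_zero_or_one k with hk' | hk'
    · have : ε k = ε i := neg_one_pow_congr (by simp only [Nat.even_iff]; omega)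
      simp [this]
    · rw [hC k i (by omega) (by omega) hk' hi']
    · rw [hC i k (by omega) (by omega) hi' hk']
    · have : ε k = ε i := neg_one_pow_congr (by simp only [Nat.even_iff]; omega)
      simp [this]
  have hsum : (fPoly q n A ((starRingEnd ℂ) x))ᴴ * fPoly q n A (-y)
      - (fPoly q n A ((starRingEnd ℂ) (-x)))ᴴ * fPoly q n A y =
      ∑ i ∈ Finset.range (n + 1), ∑ k ∈ Finset.range (n + 1), t i k := by
    simp only [fPoly, ← map_pow (starRingEnd ℂ), conjTranspose_sum_smul_mul_sum_smul,
      ← Finset.sum_sub_distrib]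
    refine Finset.sum_congr rfl fun i _ => Finset.sum_congr rfl fun k _ => ?_
    rw [← sub_smul, neg_pow x, neg_pow y]
    simp only [t, ε]
    congr 1
    ring
  have hswap : ∑ i ∈ Finset.range (n + 1), ∑ k ∈ Finset.range (n + 1), t i k =
      ∑ i ∈ Finset.range (n + 1), ∑ k ∈ Finset.range (n + 1), t k i := Finset.sum_comm
  have hhalf : ∀ M : Mat q, M = (1 / 2 : ℂ) • (M + M) := fun M => by
    rw [← two_smul ℂ M, smul_smul]; norm_num
  rw [hsum, hhalf (∑ i ∈ _, _)]
  nth_rewrite 2 [hswap]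
  simp only [Pi.smul_apply, Finset.sum_apply, ← Finset.sum_add_distrib]
  congr 1
  refine Finset.sum_congr rfl fun i hi => Finset.sum_congr rfl fun k hk => ?_
  have hki : t k i = -((x ^ (n - k) * y ^ (n - i)) • (ε k - ε i) • ((A k)ᴴ * A i)) := by
    simp only [t, smul_smul, ← neg_smul]
    congr 1
    ring
  rw [hki, ← hsymm i hi k hk]
  simp only [t, smul_smul, ← neg_smul, ← add_smul]
  congr 1
  ring

theorem part_bezout_mem_powSubPowMultiples {q n m : ℕ} {A : ℕ → Mat q} {h g : ℂ → Mat q}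
    (hn : (n = 2 * m ∧ h = hEven q m A ∧ g = gEven q m A) ∨
          (n = 2 * m + 1 ∧ h = hOdd q m A ∧ g = gOdd q m A))
    (hC : CondC q n A) (c d : ℕ) :
    (fun x y : ℂ => (x ^ c * y ^ c) •
      ((x ^ 2) ^ d • ((g ((starRingEnd ℂ) (x ^ 2)))ᴴ * h (y ^ 2)) -
        (y ^ 2) ^ d • ((h ((starRingEnd ℂ) (x ^ 2)))ᴴ * g (y ^ 2)))) ∈
      powSubPowMultiples q 2 := by
  rcases hn with ⟨rfl, rfl, rfl⟩ | ⟨rfl, rfl, rfl⟩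
  · exact bezout_mem_powSubPowMultiples 2 c d m (m + 1) (fun j => m - 1 - j) (fun j => m - j)
      (fun j => A (2 * j + 1)) (fun j => A (2 * j))
      fun i hi k hk => hC _ _ (by omega) (by omega) (by omega) (by omega)
  · exact bezout_mem_powSubPowMultiples 2 c d (m + 1) (m + 1) (fun j => m - j) (fun j => m - j)
      (fun j => A (2 * j)) (fun j => A (2 * j + 1))
      fun i hi k hk => (hC _ _ (by omega) (by omega) (by omega) (by omega)).symm

theorem stmt_10 (q n m : ℕ) (hq : 1 ≤ q) (hm : 1 ≤ m) (A : ℕ → Mat q)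
    (h g : ℂ → Mat q)
    (hn : (n = 2 * m ∧ h = hEven q m A ∧ g = gEven q m A) ∨
          (n = 2 * m + 1 ∧ h = hOdd q m A ∧ g = gOdd q m A))
    (hA0 : (A 0).det ≠ 0) (hC : CondC q n A) :
    ∃ (N : ℕ) (T1 T2 T3 : ℕ → ℕ → Mat q), ∀ x y : ℂ,
      (x ^ 2 • ((g ((starRingEnd ℂ) (x ^ 2)))ᴴ * h (y ^ 2))
          - y ^ 2 • ((h ((starRingEnd ℂ) (x ^ 2)))ᴴ * g (y ^ 2))
        = (x ^ 2 - y ^ 2) •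
            ∑ j ∈ Finset.range N, ∑ k ∈ Finset.range N, (x ^ j * y ^ k) • T1 j k) ∧
      ((x * y) • ((g ((starRingEnd ℂ) (x ^ 2)))ᴴ * h (y ^ 2)
            - (h ((starRingEnd ℂ) (x ^ 2)))ᴴ * g (y ^ 2))
        = (x ^ 2 - y ^ 2) •
            ∑ j ∈ Finset.range N, ∑ k ∈ Finset.range N, (x ^ j * y ^ k) • T2 j k) ∧
      ((fPoly q n A ((starRingEnd ℂ) x))ᴴ * fPoly q n A (-y)
          - (fPoly q n A ((starRingEnd ℂ) (-x)))ᴴ * fPoly q n A y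
        = (x - y) •
            ∑ j ∈ Finset.range N, ∑ k ∈ Finset.range N, (x ^ j * y ^ k) • T3 j k) := by
  obtain ⟨G₁, hG₁, e₁⟩ := part_bezout_mem_powSubPowMultiples hn hC 0 1
  obtain ⟨G₂, hG₂, e₂⟩ := part_bezout_mem_powSubPowMultiples hn hC 1 0
  obtain ⟨G₃, hG₃, e₃⟩ := fPoly_bezout_mem_powSubPowMultiples hC
  obtain ⟨N₁, h₁⟩ := exists_coeff_of_mem_bivariatePoly hG₁
  obtain ⟨N₂, h₂⟩ := exists_coeff_of_mem_bivariatePoly hG₂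
  obtain ⟨N₃, h₃⟩ := exists_coeff_of_mem_bivariatePoly hG₃
  obtain ⟨T₁, hT₁⟩ := h₁ (N₁ + N₂ + N₃) (by omega)
  obtain ⟨T₂, hT₂⟩ := h₂ (N₁ + N₂ + N₃) (by omega)
  obtain ⟨T₃, hT₃⟩ := h₃ (N₁ + N₂ + N₃) (by omega)
  refine ⟨N₁ + N₂ + N₃, T₁, T₂, T₃, fun x y => ⟨?_, ?_, ?_⟩⟩
  · rw [← hT₁, ← e₁]
    simp only [pow_zero, pow_one, mul_one, one_smul]
  · rw [← hT₂, ← e₂]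
    simp only [pow_zero, pow_one, one_smul]
  · simpa only [← hT₃, pow_one] using e₃ x y

end
end

section
/- Let f be a matrix polynomial of degree 2m whose coefficients satisfy Condition C, and suppose Hermitian q×q matrices s_0, ..., s_{2m-1} are Markov parameters of f. Then for all x, y ∈ ℂ: x²·g^♯(x²)·h(y²) − y²·h^♯(x²)·g(y²) = (x²−y²) · R_e(x) · S(h^♯) · J̃_{m-1} · H_{2,m-1} · J̃_{m-1} · S(h) · C_e(y), and x·y·( g^♯(x²)·h(y²) − h^♯(x²)·g(y²) ) = −(x²−y²) · R_o(x) · S(h^♯) · J̃_{m-1} · H_{1,m-1} · J̃_{m-1} · S(h) · C_o(y), where R_e(x) is the block row (I_q, x² I_q, ..., x^{2m-2} I_q), C_e(y) the block column (I_q; y² I_q; ...; y^{2m-2} I_q), R_o(x) the block row (x I_q, x³ I_q, ..., x^{2m-1} I_q), and C_o(y) the block column (y I_q; y³ I_q; ...; y^{2m-1} I_q). -/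
open Matrix MeasureTheory
open scoped ComplexOrder

noncomputable section

/-- The double convolution `∑_{i,k<N} h'_{a+i} τ_{i+k} h_{k+b}`. -/
def hankelForm {R : Type*} [Ring R] (N : ℕ) (h' τ h : ℕ → R) (a b : ℕ) : R :=
  ∑ i ∈ Finset.range N, ∑ k ∈ Finset.range N, h' (a + i) * τ (i + k) * h (k + b)

theorem hankelForm_shift {R : Type*} [Ring R] (N : ℕ) (h' τ h : ℕ → R)
    (hh' : ∀ n, N ≤ n → h' n = 0) (hh : ∀ n, N ≤ n → h n = 0) (a b : ℕ) :
    hankelForm N h' τ h a (b + 1) - hankelForm N h' τ h (a + 1) b =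
      h' a * ∑ k ∈ Finset.range N, τ k * h (k + b + 1)
        - (∑ i ∈ Finset.range N, h' (a + i + 1) * τ i) * h b := by
  have e1 : hankelForm N h' τ h a (b + 1) =
      ∑ i ∈ Finset.range N, ∑ k ∈ Finset.range N, h' (a + i + 1) * τ (i + k + 1) * h (k + b + 1)
        + h' a * ∑ k ∈ Finset.range N, τ k * h (k + b + 1) := by
    have e : hankelForm N h' τ h a (b + 1) = ∑ i ∈ Finset.range (N + 1),
        ∑ k ∈ Finset.range N, h' (a + i) * τ (i + k) * h (k + (b + 1)) := by
      rw [Finset.sum_range_succ, hankelForm, hh' (a + N) (by omega)]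
      simp
    rw [e, Finset.sum_range_succ', Finset.mul_sum]
    simp only [mul_assoc, add_assoc, add_zero, zero_add, add_comm 1]
  have e2 : hankelForm N h' τ h (a + 1) b =
      ∑ i ∈ Finset.range N, ∑ k ∈ Finset.range N, h' (a + i + 1) * τ (i + k + 1) * h (k + b + 1)
        + (∑ i ∈ Finset.range N, h' (a + i + 1) * τ i) * h b := by
    rw [hankelForm, Finset.sum_mul, ← Finset.sum_add_distrib]
    refine Finset.sum_congr rfl fun i _ => ?_
    have e : ∑ k ∈ Finset.range N, h' (a + 1 + i) * τ (i + k) * h (k + b) =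
        ∑ k ∈ Finset.range (N + 1), h' (a + 1 + i) * τ (i + k) * h (k + b) := by
      rw [Finset.sum_range_succ, hh (N + b) (by omega)]
      simp
    rw [e, Finset.sum_range_succ']
    simp only [add_zero, zero_add, add_right_comm _ 1, ← add_assoc]
  rw [e1, e2]
  abel

theorem hankelForm_eq_zero_left {R : Type*} [Ring R] (N : ℕ) (h' τ h : ℕ → R)
    (hh' : ∀ n, N ≤ n → h' n = 0) (a b : ℕ) (ha : N ≤ a) : hankelForm N h' τ h a b = 0 :=
  Finset.sum_eq_zero fun i _ => Finset.sum_eq_zero fun k _ => by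
    rw [hh' (a + i) (by omega)]; simp

theorem hankelForm_eq_zero_right {R : Type*} [Ring R] (N : ℕ) (h' τ h : ℕ → R)
    (hh : ∀ n, N ≤ n → h n = 0) (a b : ℕ) (hb : N ≤ b) : hankelForm N h' τ h a b = 0 :=
  Finset.sum_eq_zero fun i _ => Finset.sum_eq_zero fun k _ => by
    rw [hh (k + b) (by omega)]; simp

theorem sub_smul_sum_eq_sum_shift {R : Type*} [AddCommGroup R] [Module ℂ R] (m : ℕ)
    (F : ℕ → ℕ → R) (hl : ∀ a b, m + 1 ≤ a → F a b = 0) (hr : ∀ a b, m + 1 ≤ b → F a b = 0)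
    (u v : ℂ) :
    (u - v) • ∑ a ∈ Finset.range m, ∑ b ∈ Finset.range m, (u ^ a * v ^ b) • F (a + 1) (b + 1) =
      ∑ a ∈ Finset.range (m + 1), ∑ b ∈ Finset.range (m + 1),
          (u ^ a * v ^ b) • (F a (b + 1) - F (a + 1) b)
        - ∑ b ∈ Finset.range (m + 1), v ^ b • F 0 (b + 1)
        + ∑ a ∈ Finset.range (m + 1), u ^ a • F (a + 1) 0 := by
  have e1 : ∑ a ∈ Finset.range (m + 1), ∑ b ∈ Finset.range (m + 1),
      (u ^ a * v ^ b) • F a (b + 1) =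
      u • ∑ a ∈ Finset.range m, ∑ b ∈ Finset.range m, (u ^ a * v ^ b) • F (a + 1) (b + 1)
        + ∑ b ∈ Finset.range (m + 1), v ^ b • F 0 (b + 1) := by
    rw [Finset.sum_range_succ']
    simp only [pow_zero, one_mul]
    congr 1
    rw [Finset.smul_sum]
    refine Finset.sum_congr rfl fun a _ => ?_
    rw [Finset.sum_range_succ, hr _ (m + 1) le_rfl, smul_zero, add_zero, Finset.smul_sum]
    refine Finset.sum_congr rfl fun b _ => ?_
    rw [smul_smul]
    ring_nf
  have e2 : ∑ a ∈ Finset.range (m + 1), ∑ b ∈ Finset.range (m + 1),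
      (u ^ a * v ^ b) • F (a + 1) b =
      v • ∑ a ∈ Finset.range m, ∑ b ∈ Finset.range m, (u ^ a * v ^ b) • F (a + 1) (b + 1)
        + ∑ a ∈ Finset.range (m + 1), u ^ a • F (a + 1) 0 := by
    simp only [fun a => Finset.sum_range_succ' (fun b => (u ^ a * v ^ b) • F (a + 1) b) m,
      Finset.sum_add_distrib, pow_zero, mul_one]
    congr 1
    rw [Finset.sum_range_succ, Finset.smul_sum]
    simp only [hl (m + 1) _ le_rfl, smul_zero, Finset.sum_const_zero, add_zero, Finset.smul_sum]
    refine Finset.sum_congr rfl fun a _ => Finset.sum_congr rfl fun b _ => ?_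
    rw [smul_smul]
    ring_nf
  simp only [smul_sub, Finset.sum_sub_distrib, e1, e2, sub_smul]
  abel

theorem sum_smul_mul_sum_smul {R : Type*} [Ring R] [Algebra ℂ R] (N : ℕ) (α β : ℕ → R)
    (u v : ℂ) :
    (∑ a ∈ Finset.range N, u ^ a • α a) * ∑ b ∈ Finset.range N, v ^ b • β b =
      ∑ a ∈ Finset.range N, ∑ b ∈ Finset.range N, (u ^ a * v ^ b) • (α a * β b) := by
  simp only [Finset.sum_mul_sum, smul_mul_smul_comm]

/-- The Bezoutian generated by a Hankel form, with its boundary terms. -/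
theorem sub_smul_sum_hankelForm {R : Type*} [Ring R] [Algebra ℂ R] (m : ℕ) (h' τ h : ℕ → R)
    (hh' : ∀ n, m + 1 ≤ n → h' n = 0) (hh : ∀ n, m + 1 ≤ n → h n = 0) (u v : ℂ) :
    (u - v) • ∑ a ∈ Finset.range m, ∑ b ∈ Finset.range m,
        (u ^ a * v ^ b) • hankelForm (m + 1) h' τ h (a + 1) (b + 1) =
      (∑ a ∈ Finset.range (m + 1), u ^ a • h' a) *
          (∑ b ∈ Finset.range (m + 1), v ^ b •
            ∑ k ∈ Finset.range (m + 1), τ k * h (k + b + 1))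
        - (∑ a ∈ Finset.range (m + 1), u ^ a •
            ∑ i ∈ Finset.range (m + 1), h' (a + i + 1) * τ i) *
          (∑ b ∈ Finset.range (m + 1), v ^ b • h b)
        - ∑ b ∈ Finset.range (m + 1), v ^ b • hankelForm (m + 1) h' τ h 0 (b + 1)
        + ∑ a ∈ Finset.range (m + 1), u ^ a • hankelForm (m + 1) h' τ h (a + 1) 0 := by
  rw [sub_smul_sum_eq_sum_shift m (hankelForm (m + 1) h' τ h)
    (fun a b => hankelForm_eq_zero_left _ _ _ _ hh' a b)
    (fun a b => hankelForm_eq_zero_right _ _ _ _ hh a b)]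
  simp only [hankelForm_shift (m + 1) h' τ h hh' hh, sum_smul_mul_sum_smul, smul_sub,
    Finset.sum_sub_distrib]

/-- A polynomial over complex matrices vanishing at all scalar matrices is zero. -/
theorem eq_zero_of_eval_scalar_eq_zero {q : ℕ} (p : Polynomial (Mat q))
    (hp : ∀ z : ℂ, p.eval (z • (1 : Mat q)) = 0) : p = 0 := by
  ext n i j
  let P : Polynomial ℂ := ∑ k ∈ Finset.range (p.natDegree + 1),
    Polynomial.C (p.coeff k i j) * Polynomial.X ^ k
  have hP : P = 0 := Polynomial.funext fun z => by
    have hz := congrFun (congrFun (hp z) i) j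
    rw [Polynomial.eval_eq_sum_range] at hz
    simp only [smul_pow, one_pow, mul_smul_comm, mul_one, Matrix.sum_apply, Matrix.smul_apply,
      smul_eq_mul, Matrix.zero_apply] at hz
    simp only [P, Polynomial.eval_finsetSum, Polynomial.eval_C_mul, Polynomial.eval_pow,
      Polynomial.eval_X, Polynomial.eval_zero, mul_comm _ (z ^ _)]
    exact hz
  have hn := congrArg (fun Q => Polynomial.coeff Q n) hP
  simp only [P, Polynomial.finsetSum_coeff, Polynomial.coeff_C_mul_X_pow,
    Polynomial.coeff_zero, Finset.sum_ite_eq, Finset.mem_range] at hn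
  split_ifs at hn with hlt
  · simpa using hn
  · rw [Polynomial.coeff_eq_zero_of_natDegree_lt (by omega)]
    rfl

/-- Ascending coefficients of `hEven`. -/
def hCoeff (q m : ℕ) (A : ℕ → Mat q) (n : ℕ) : Mat q := if n ≤ m then A (2 * (m - n)) else 0

/-- Ascending coefficients of `gEven`. -/
def gCoeff (q m : ℕ) (A : ℕ → Mat q) (n : ℕ) : Mat q :=
  if n < m then A (2 * (m - 1 - n) + 1) else 0

theorem hCoeff_eq_zero (q m : ℕ) (A : ℕ → Mat q) (n : ℕ) (hn : m + 1 ≤ n) :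
    hCoeff q m A n = 0 := if_neg (by omega)

theorem gCoeff_eq_zero (q m : ℕ) (A : ℕ → Mat q) (n : ℕ) (hn : m ≤ n) :
    gCoeff q m A n = 0 := if_neg (by omega)

theorem hEven_eq (q m : ℕ) (A : ℕ → Mat q) (z : ℂ) :
    hEven q m A z = ∑ n ∈ Finset.range (m + 1), z ^ n • hCoeff q m A n := by
  rw [hEven, ← Finset.sum_range_reflect]
  refine Finset.sum_congr rfl fun j hj => ?_
  rw [Finset.mem_range] at hj
  rw [hCoeff, if_pos (by omega), show m + 1 - 1 - j = m - j by omega,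
    show m - (m - j) = j by omega]

theorem gEven_eq (q m : ℕ) (A : ℕ → Mat q) (z : ℂ) :
    gEven q m A z = ∑ n ∈ Finset.range m, z ^ n • gCoeff q m A n := by
  rw [gEven, ← Finset.sum_range_reflect]
  refine Finset.sum_congr rfl fun j hj => ?_
  rw [Finset.mem_range] at hj
  rw [gCoeff, if_pos (by omega), show m - 1 - (m - 1 - j) = j by omega]

/-- The alternating Markov parameters `(-1)^j s_j`, extended by zero beyond `2m-1`. -/
def altMarkov (q m : ℕ) (s : ℕ → Mat q) (j : ℕ) : Mat q :=
  if j < 2 * m then (-1 : ℂ) ^ j • s j else 0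

theorem markovEven_coeff {q m : ℕ} {A s : ℕ → Mat q} (hM : MarkovEven q m A s) (n : ℕ)
    (hn : m ≤ n) :
    ∑ j ∈ Finset.range (2 * m), (if 2 * m ≤ n + 1 + j then
        altMarkov q m s j * hCoeff q m A (n + 1 + j - 2 * m) else 0) =
      if 2 * m ≤ n then gCoeff q m A (n - 2 * m) else 0 := by
  obtain ⟨B, hB⟩ := hM
  let toPoly : ℕ → (ℕ → Mat q) → Polynomial (Mat q) := fun N c =>
    ∑ k ∈ Finset.range N, Polynomial.C (c k) * Polynomial.X ^ k
  have heval : ∀ N c (z : ℂ), (toPoly N c).eval (z • (1 : Mat q)) =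
      ∑ k ∈ Finset.range N, z ^ k • c k := fun N c z => by
    simp [toPoly, Polynomial.eval_finsetSum, smul_pow]
  have hcoeff : ∀ N c k, (toPoly N c).coeff k = if k < N then c k else 0 := fun N c k => by
    simp [toPoly, Polynomial.finsetSum_coeff]
  let Sp : Polynomial (Mat q) := ∑ j ∈ Finset.range (2 * m),
    Polynomial.C (altMarkov q m s j) * Polynomial.X ^ (2 * m - 1 - j)
  have hS : ∀ z : ℂ, Sp.eval (z • (1 : Mat q)) =
      ∑ j ∈ Finset.range (2 * m), ((-1 : ℂ) ^ j * z ^ (2 * m - 1 - j)) • s j := fun z => by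
    simp only [Sp, Polynomial.eval_finsetSum]
    refine Finset.sum_congr rfl fun j hj => ?_
    rw [Finset.mem_range] at hj
    rw [altMarkov, if_pos hj]
    simp [smul_pow, smul_smul, mul_comm]
  have hmul : ∀ (P Q : Polynomial (Mat q)) (z : ℂ), (P * Q).eval (z • (1 : Mat q)) =
      P.eval (z • (1 : Mat q)) * Q.eval (z • (1 : Mat q)) := fun P Q z =>
    Polynomial.eval₂_mul_noncomm _ _ fun k => (Commute.one_right (Q.coeff k)).smul_right z
  have h0 : toPoly m (gCoeff q m A) * Polynomial.X ^ (2 * m)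
      - Sp * toPoly (m + 1) (hCoeff q m A) - toPoly m B = 0 := by
    refine eq_zero_of_eval_scalar_eq_zero _ fun z => ?_
    rw [Polynomial.eval_sub, Polynomial.eval_sub, Polynomial.eval_mul_X_pow, hmul, heval,
      heval, heval, hS, ← gEven_eq, ← hEven_eq, ← hB z]
    simp [smul_pow]
  have hn0 := congrArg (fun Q => Polynomial.coeff Q n) h0
  simp only [Polynomial.coeff_sub, hcoeff, Polynomial.coeff_mul_X_pow', Polynomial.coeff_zero,
    if_neg (not_lt.mpr hn), sub_zero, Sp, Finset.sum_mul, Polynomial.finsetSum_coeff,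
    mul_assoc, Polynomial.coeff_C_mul, Polynomial.coeff_X_pow_mul'] at hn0
  rw [sub_eq_zero] at hn0
  calc _ = _ := ?_
    _ = _ := hn0.symm
    _ = _ := ?_
  · refine Finset.sum_congr rfl fun j hj => ?_
    rw [Finset.mem_range] at hj
    by_cases hc : 2 * m ≤ n + 1 + j
    · rw [if_pos hc, if_pos (by omega), show n - (2 * m - 1 - j) = n + 1 + j - 2 * m by omega]
      split_ifs with hlt
      · rfl
      · rw [hCoeff_eq_zero _ _ _ _ (by omega)]
    · rw [if_neg hc, if_neg (by omega), mul_zero]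
  · split_ifs with h1 h2
    · rfl
    · rw [gCoeff_eq_zero _ _ _ _ (by omega)]
    · rfl

theorem sum_altMarkov_mul_hCoeff_succ {q m : ℕ} {A s : ℕ → Mat q} (hm : 1 ≤ m)
    (hM : MarkovEven q m A s) (k : ℕ) :
    ∑ i ∈ Finset.range (m + 1), altMarkov q m s i * hCoeff q m A (i + k + 1) =
      gCoeff q m A k := by
  have h := markovEven_coeff hM (2 * m + k) (by omega)
  rw [if_pos (by omega), Nat.add_sub_cancel_left] at h
  rw [← h]
  refine Finset.sum_subset_zero_on_sdiff (Finset.range_mono (by omega)) (fun i hi => ?_)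
    fun i _ => ?_
  · simp only [Finset.mem_sdiff, Finset.mem_range] at hi
    rw [if_pos (by omega), hCoeff_eq_zero _ _ _ _ (by omega), mul_zero]
  · rw [if_pos (by omega), show 2 * m + k + 1 + i - 2 * m = i + k + 1 by omega]

theorem sum_altMarkov_mul_hCoeff_eq_zero {q m : ℕ} {A s : ℕ → Mat q}
    (hM : MarkovEven q m A s) (p : ℕ) (hp : p < m) :
    ∑ i ∈ Finset.range (m + 1), altMarkov q m s (i + p) * hCoeff q m A i = 0 := by
  have h := markovEven_coeff hM (2 * m - 1 - p) (by omega)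
  rw [if_neg (by omega), show 2 * m = p + (2 * m - p) by omega, Finset.sum_range_add,
    Finset.sum_eq_zero, zero_add] at h
  · rw [← h]
    refine Finset.sum_subset_zero_on_sdiff (Finset.range_mono (by omega)) (fun i hi => ?_)
      fun i hi => ?_
    · simp only [Finset.mem_sdiff, Finset.mem_range] at hi
      rw [if_pos (by omega), hCoeff_eq_zero _ _ _ _ (by omega), mul_zero]
    · rw [if_pos (by omega), add_comm p i]
      congr 2
      omega
  · intro i hi
    rw [Finset.mem_range] at hi
    rw [if_neg (by omega)]

theorem altMarkov_conjTranspose {q m : ℕ} {s : ℕ → Mat q}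
    (hherm : ∀ j < 2 * m, (s j).IsHermitian) (j : ℕ) :
    (altMarkov q m s j)ᴴ = altMarkov q m s j := by
  unfold altMarkov
  split_ifs with hj
  · simp [Matrix.conjTranspose_smul, (hherm j hj).eq]
  · simp

theorem hankelForm_conjTranspose {q : ℕ} (N : ℕ) (h τ : ℕ → Mat q) (hτ : ∀ j, (τ j)ᴴ = τ j)
    (a b : ℕ) :
    (hankelForm N (fun n => (h n)ᴴ) τ h a b)ᴴ = hankelForm N (fun n => (h n)ᴴ) τ h b a := by
  unfold hankelForm
  simp only [Matrix.conjTranspose_sum, Matrix.conjTranspose_mul,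
    Matrix.conjTranspose_conjTranspose, hτ]
  rw [Finset.sum_comm]
  refine Finset.sum_congr rfl fun i _ => Finset.sum_congr rfl fun k _ => ?_
  rw [add_comm k i, add_comm k a, add_comm b i, mul_assoc]

theorem hankelForm_zero_left {R : Type*} [Ring R] (N : ℕ) (h' τ h : ℕ → R) (b : ℕ)
    (hz : ∀ k < N, h (k + b) = 0 ∨ ∑ i ∈ Finset.range N, h' i * τ (i + k) = 0) :
    hankelForm N h' τ h 0 b = 0 := by
  rw [hankelForm, Finset.sum_comm]
  refine Finset.sum_eq_zero fun k hk => ?_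
  simp only [zero_add]
  rw [← Finset.sum_mul]
  rcases hz k (Finset.mem_range.mp hk) with h0 | h0 <;> simp [h0]

theorem conjTranspose_gEven (q m : ℕ) (A : ℕ → Mat q) (u : ℂ) :
    (gEven q m A ((starRingEnd ℂ) u))ᴴ = ∑ n ∈ Finset.range m, u ^ n • (gCoeff q m A n)ᴴ := by
  simp [gEven_eq, Matrix.conjTranspose_sum, Matrix.conjTranspose_smul]

theorem conjTranspose_hEven (q m : ℕ) (A : ℕ → Mat q) (u : ℂ) :
    (hEven q m A ((starRingEnd ℂ) u))ᴴ =
      ∑ n ∈ Finset.range (m + 1), u ^ n • (hCoeff q m A n)ᴴ := by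
  simp [hEven_eq, Matrix.conjTranspose_sum, Matrix.conjTranspose_smul]

theorem bezoutian_odd {q m : ℕ} {A s : ℕ → Mat q} (hm : 1 ≤ m)
    (hherm : ∀ j < 2 * m, (s j).IsHermitian) (hM : MarkovEven q m A s) (u v : ℂ) :
    (gEven q m A ((starRingEnd ℂ) u))ᴴ * hEven q m A v
        - (hEven q m A ((starRingEnd ℂ) u))ᴴ * gEven q m A v =
      -((u - v) • ∑ a ∈ Finset.range m, ∑ b ∈ Finset.range m, (u ^ a * v ^ b) •
        hankelForm (m + 1) (fun n => (hCoeff q m A n)ᴴ) (altMarkov q m s) (hCoeff q m A)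
          (a + 1) (b + 1)) := by
  have hτ := altMarkov_conjTranspose (q := q) hherm
  have hadj : ∀ a, ∑ i ∈ Finset.range (m + 1), (hCoeff q m A (a + i + 1))ᴴ * altMarkov q m s i =
      (gCoeff q m A a)ᴴ := fun a => by
    rw [← sum_altMarkov_mul_hCoeff_succ hm hM a]
    simp [Matrix.conjTranspose_sum, hτ, add_comm a]
  have hleft : ∀ b, hankelForm (m + 1) (fun n => (hCoeff q m A n)ᴴ) (altMarkov q m s)
      (hCoeff q m A) 0 (b + 1) = 0 := fun b => by
    refine hankelForm_zero_left _ _ _ _ _ fun k hk => ?_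
    rcases lt_or_ge k m with hkm | hkm
    · right
      have := congrArg Matrix.conjTranspose (sum_altMarkov_mul_hCoeff_eq_zero hM k hkm)
      simpa [Matrix.conjTranspose_sum, hτ] using this
    · left
      exact hCoeff_eq_zero _ _ _ _ (by omega)
  have hright : ∀ a, hankelForm (m + 1) (fun n => (hCoeff q m A n)ᴴ) (altMarkov q m s)
      (hCoeff q m A) (a + 1) 0 = 0 := fun a => by
    rw [← hankelForm_conjTranspose _ _ _ hτ, hleft, Matrix.conjTranspose_zero]
  rw [sub_smul_sum_hankelForm m _ _ _
    (fun n hn => by simp [hCoeff_eq_zero q m A n hn]) (hCoeff_eq_zero q m A)]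
  simp only [hleft, hright, hadj, sum_altMarkov_mul_hCoeff_succ hm hM, smul_zero,
    Finset.sum_const_zero, sub_zero, add_zero, conjTranspose_gEven, conjTranspose_hEven]
  rw [gEven_eq, hEven_eq, Finset.sum_range_succ (fun b => v ^ b • gCoeff q m A b),
    Finset.sum_range_succ (fun b => u ^ b • (gCoeff q m A b)ᴴ), gCoeff_eq_zero q m A m le_rfl]
  simp

theorem bezoutian_even {q m : ℕ} {A s : ℕ → Mat q} (hm : 1 ≤ m)
    (hherm : ∀ j < 2 * m, (s j).IsHermitian) (hM : MarkovEven q m A s) (u v : ℂ) :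
    u • ((gEven q m A ((starRingEnd ℂ) u))ᴴ * hEven q m A v)
        - v • ((hEven q m A ((starRingEnd ℂ) u))ᴴ * gEven q m A v) =
      -((u - v) • ∑ a ∈ Finset.range m, ∑ b ∈ Finset.range m, (u ^ a * v ^ b) •
        hankelForm (m + 1) (fun n => (hCoeff q m A n)ᴴ) (fun j => altMarkov q m s (j + 1))
          (hCoeff q m A) (a + 1) (b + 1)) := by
  have hτ := altMarkov_conjTranspose (q := q) hherm
  let γ : ℕ → Mat q := fun b => if b = 0 then 0 else gCoeff q m A (b - 1)
  have hγ : ∀ b, ∑ k ∈ Finset.range (m + 1), altMarkov q m s (k + 1) * hCoeff q m A (k + b + 1) =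
      γ b - altMarkov q m s 0 * hCoeff q m A b := fun b => by
    have e : ∑ k ∈ Finset.range (m + 1), altMarkov q m s k * hCoeff q m A (k + b) = γ b := by
      rcases b with _ | b
      · simpa [γ] using sum_altMarkov_mul_hCoeff_eq_zero hM 0 hm
      · exact sum_altMarkov_mul_hCoeff_succ hm hM b
    have e' : ∑ k ∈ Finset.range (m + 2), altMarkov q m s k * hCoeff q m A (k + b) = γ b := by
      rw [Finset.sum_range_succ, e, hCoeff_eq_zero q m A (m + 1 + b) (by omega)]
      simp
    rw [← e', Finset.sum_range_succ' _ (m + 1), zero_add, add_sub_cancel_right]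
    simp only [add_right_comm _ b 1]
  have hγ' : ∀ a, ∑ i ∈ Finset.range (m + 1),
      (hCoeff q m A (a + i + 1))ᴴ * altMarkov q m s (i + 1) =
      (γ a)ᴴ - (hCoeff q m A a)ᴴ * altMarkov q m s 0 := fun a => by
    have := congrArg Matrix.conjTranspose (hγ a)
    simpa [Matrix.conjTranspose_sum, hτ, add_comm a] using this
  set F := hankelForm (m + 1) (fun n => (hCoeff q m A n)ᴴ) (fun j => altMarkov q m s (j + 1))
    (hCoeff q m A) with hF
  have hleft : ∀ b, F 0 (b + 1 + 1) = 0 := fun b => by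
    refine hankelForm_zero_left _ _ _ _ _ fun k hk => ?_
    rcases lt_or_ge (k + 1) m with hkm | hkm
    · right
      have := congrArg Matrix.conjTranspose (sum_altMarkov_mul_hCoeff_eq_zero hM (k + 1) hkm)
      simpa [Matrix.conjTranspose_sum, hτ, add_assoc] using this
    · left
      exact hCoeff_eq_zero _ _ _ _ (by omega)
  have hconj : ∀ a b, (F a b)ᴴ = F b a := hankelForm_conjTranspose _ _ _ fun j => hτ (j + 1)
  have hright : ∀ a, F (a + 1 + 1) 0 = 0 := fun a => by
    rw [← hconj, hleft, Matrix.conjTranspose_zero]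
  have hcorner : F 0 1 = F 1 0 := by
    have h := hankelForm_shift (m + 1) (fun n => (hCoeff q m A n)ᴴ)
      (fun j => altMarkov q m s (j + 1)) (hCoeff q m A)
      (fun n hn => by simp [hCoeff_eq_zero q m A n hn]) (hCoeff_eq_zero q m A) 0 0
    have h1 := hγ 0
    have h2 := hγ' 0
    simp only [← hF, h1, h2] at h
    simpa [γ, mul_assoc, sub_eq_zero] using h
  have hγsum : ∑ b ∈ Finset.range (m + 1), v ^ b • γ b = v • gEven q m A v := by
    rw [Finset.sum_range_succ', gEven_eq, Finset.smul_sum]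
    simp [γ, smul_smul, pow_succ']
  have hγsum' : ∑ b ∈ Finset.range (m + 1), u ^ b • (γ b)ᴴ =
      u • (gEven q m A ((starRingEnd ℂ) u))ᴴ := by
    rw [Finset.sum_range_succ', conjTranspose_gEven, Finset.smul_sum]
    simp [γ, smul_smul, pow_succ']
  have hb : ∑ b ∈ Finset.range (m + 1), v ^ b • F 0 (b + 1) = F 0 1 := by
    rw [Finset.sum_range_succ']
    simp [hleft]
  have ha : ∑ a ∈ Finset.range (m + 1), u ^ a • F (a + 1) 0 = F 1 0 := by
    rw [Finset.sum_range_succ']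
    simp [hright]
  rw [hF, sub_smul_sum_hankelForm m _ _ _
    (fun n hn => by simp [hCoeff_eq_zero q m A n hn]) (hCoeff_eq_zero q m A), ← hF, ha, hb,
    hcorner]
  have hσ : ∑ b ∈ Finset.range (m + 1), v ^ b • (altMarkov q m s 0 * hCoeff q m A b) =
      altMarkov q m s 0 * hEven q m A v := by
    simp [hEven_eq, Finset.mul_sum]
  have hσ' : ∑ a ∈ Finset.range (m + 1), u ^ a • ((hCoeff q m A a)ᴴ * altMarkov q m s 0) =
      (hEven q m A ((starRingEnd ℂ) u))ᴴ * altMarkov q m s 0 := by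
    simp [conjTranspose_hEven, Finset.sum_mul]
  simp only [hγ, hγ', smul_sub, Finset.sum_sub_distrib, hγsum, hγsum', hσ, hσ',
    ← conjTranspose_hEven, ← hEven_eq, mul_sub, sub_mul, mul_assoc, smul_mul_assoc,
    mul_smul_comm]
  abel

/-- The matrix with `q × q` blocks `M i k`. -/
def blockMat (q n : ℕ) (M : ℕ → ℕ → Mat q) : Matrix (Fin n × Fin q) (Fin n × Fin q) ℂ :=
  Matrix.of fun p r => M p.1 r.1 p.2 r.2

theorem blockMat_mul (q n : ℕ) (M N : ℕ → ℕ → Mat q) :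
    blockMat q n M * blockMat q n N =
      blockMat q n fun i k => ∑ j ∈ Finset.range n, M i j * N j k := by
  ext p r
  simp [blockMat, Matrix.mul_apply, Fintype.sum_prod_type, Finset.sum_range, Matrix.sum_apply]

theorem Rev_mul_blockMat_mul_Cev (q n : ℕ) (M : ℕ → ℕ → Mat q) (x y : ℂ) :
    Rev q n x * (blockMat q n M * Cev q n y) =
      ∑ a ∈ Finset.range n, ∑ b ∈ Finset.range n, ((x ^ 2) ^ a * (y ^ 2) ^ b) • M a b := by
  ext i j
  simp only [Rev, Cev, blockMat, Matrix.mul_apply, Fintype.sum_prod_type, Finset.sum_range,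
    Matrix.sum_apply, Matrix.of_apply, Matrix.smul_apply, smul_eq_mul]
  simp [Finset.mul_sum, ← pow_mul, mul_comm, mul_left_comm]

theorem Sh_eq_blockMat (q m : ℕ) (A : ℕ → Mat q) :
    Sh q m A = blockMat q m fun i k => hCoeff q m A (i + k + 1) := by
  ext p r
  have := p.1.2
  simp only [Sh, blockMat, hCoeff, Matrix.of_apply]
  split_ifs with h1 h2 h2
  · congr 2
    omega
  · omega
  · omega
  · rfl

theorem hCoeff_conjTranspose (q m : ℕ) (A : ℕ → Mat q) (n : ℕ) :
    hCoeff q m (fun i => (A i)ᴴ) n = (hCoeff q m A n)ᴴ := by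
  unfold hCoeff
  split_ifs <;> simp

theorem Jt_mul_mul_Jt (q n : ℕ) (M : ℕ → ℕ → Mat q) :
    Jt q n * blockMat q n M * Jt q n =
      blockMat q n fun i k => (-1 : ℂ) ^ (i + k) • M i k := by
  ext p r
  simp only [Jt, blockMat, Matrix.mul_diagonal, Matrix.diagonal_mul, Matrix.of_apply,
    Matrix.smul_apply, smul_eq_mul, pow_add]
  ring

theorem Rod_eq (q n : ℕ) (x : ℂ) : Rod q n x = x • Rev q n x := by
  ext a p
  simp [Rod, Rev, pow_succ, mul_comm]

theorem Cod_eq (q n : ℕ) (y : ℂ) : Cod q n y = y • Cev q n y := by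
  ext p b
  simp [Cod, Cev, pow_succ, mul_comm]

theorem Rev_mul_Sh_mul_Cev (q m : ℕ) (A : ℕ → Mat q) (M : ℕ → ℕ → Mat q) (τ : ℕ → Mat q)
    (hτ : ∀ i k, i < m → k < m → (-1 : ℂ) ^ (i + k) • M i k = τ (i + k)) (x y : ℂ) :
    Rev q m x * (Sh q m (fun i => (A i)ᴴ) * (Jt q m * (blockMat q m M *
        (Jt q m * (Sh q m A * Cev q m y))))) =
      ∑ a ∈ Finset.range m, ∑ b ∈ Finset.range m, ((x ^ 2) ^ a * (y ^ 2) ^ b) •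
        hankelForm (m + 1) (fun n => (hCoeff q m A n)ᴴ) τ (hCoeff q m A) (a + 1) (b + 1) := by
  have e : Sh q m (fun i => (A i)ᴴ) * (Jt q m * (blockMat q m M *
        (Jt q m * (Sh q m A * Cev q m y)))) =
      Sh q m (fun i => (A i)ᴴ) * ((Jt q m * blockMat q m M * Jt q m) * Sh q m A)
        * Cev q m y := by
    simp only [Matrix.mul_assoc]
  rw [e, Jt_mul_mul_Jt, Sh_eq_blockMat, Sh_eq_blockMat, blockMat_mul, blockMat_mul,
    Rev_mul_blockMat_mul_Cev]
  refine Finset.sum_congr rfl fun a _ => Finset.sum_congr rfl fun b _ => ?_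
  congr 1
  rw [hankelForm, Finset.sum_range_succ, hCoeff_eq_zero q m A (a + 1 + m) (by omega)]
  simp only [Matrix.conjTranspose_zero, zero_mul, Finset.sum_const_zero, add_zero]
  refine Finset.sum_congr rfl fun i hi => ?_
  rw [Finset.sum_range_succ, hCoeff_eq_zero q m A (m + (b + 1)) (by omega), mul_zero, add_zero,
    Finset.mul_sum]
  refine Finset.sum_congr rfl fun k hk => ?_
  rw [hCoeff_conjTranspose, hτ i k (Finset.mem_range.mp hi) (Finset.mem_range.mp hk),
    add_right_comm a 1 i, ← add_assoc k b 1, mul_assoc]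

theorem stmt_11 (q m : ℕ) (hq : 1 ≤ q) (hm : 1 ≤ m) (A s : ℕ → Mat q)
    (hA0 : (A 0).det ≠ 0) (hC : CondC q (2 * m) A)
    (hherm : ∀ j < 2 * m, (s j).IsHermitian) (hM : MarkovEven q m A s) :
    ∀ x y : ℂ,
      (x ^ 2 • ((gEven q m A ((starRingEnd ℂ) (x ^ 2)))ᴴ * hEven q m A (y ^ 2))
          - y ^ 2 • ((hEven q m A ((starRingEnd ℂ) (x ^ 2)))ᴴ * gEven q m A (y ^ 2))
        = (x ^ 2 - y ^ 2) •
            (Rev q m x * (Sh q m (fun i => (A i)ᴴ) * (Jt q m * (H2b q s m *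
              (Jt q m * (Sh q m A * Cev q m y))))))) ∧
      ((x * y) • ((gEven q m A ((starRingEnd ℂ) (x ^ 2)))ᴴ * hEven q m A (y ^ 2)
            - (hEven q m A ((starRingEnd ℂ) (x ^ 2)))ᴴ * gEven q m A (y ^ 2))
        = -((x ^ 2 - y ^ 2) •
            (Rod q m x * (Sh q m (fun i => (A i)ᴴ) * (Jt q m * (H1b q s m *
              (Jt q m * (Sh q m A * Cod q m y)))))))) := by
  intro x y
  constructor
  · rw [bezoutian_even hm hherm hM,
      show H2b q s m = blockMat q m fun i k => s (i + k + 1) from rfl,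
      Rev_mul_Sh_mul_Cev q m A _ (fun j => -altMarkov q m s (j + 1))]
    · simp only [hankelForm, mul_neg, neg_mul, Finset.sum_neg_distrib, smul_neg]
    · intro i k hi hk
      rw [altMarkov, if_pos (by omega), pow_succ, mul_neg_one, neg_smul, neg_neg]
  · rw [bezoutian_odd hm hherm hM, show H1b q s m = blockMat q m fun i k => s (i + k) from rfl,
      Rod_eq, Cod_eq]
    simp only [Matrix.mul_smul, Matrix.smul_mul]
    rw [Rev_mul_Sh_mul_Cev q m A _ (altMarkov q m s)]
    · simp only [smul_neg, smul_smul]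
      congr 2
      ring
    · intro i k hi hk
      rw [altMarkov, if_pos (by omega)]
end
end
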